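/- arXiv:1003.4856 — 2 statements merged into one kernel-verified Lean document; each statement's English description precedes it below -/
import Mathlib

section
/- Let (Σ, T, μ) be an α-mixing shift system and A_n ∈ ℱ_0^{n-1} a sequence with μ(A_n) > 0 and μ(τ_{A_n} ≤ n) → 0 as n → ∞. Then, with the same normalizing constants λ(A_n) ∈ (0, 2] as for the hitting-time statement, the rescaled return time satisfies: for every s > 0, sup_{t ≥ s} |λ(A_n)^{−1} μ({x : λ(A_n)μ(A_n)τ_{A_n}(x) > t} | A_n) − e^{−t}| → 0 as n → ∞, where μ(· | A_n) denotes the conditional measure on A_n. -/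
open MeasureTheory Filter Set
open scoped ENNReal Topology

noncomputable section

/-- First hitting time (at time ≥ 1) of the set `A` under `T`, valued in `ℕ∞`. -/
def hitTime {X : Type*} (T : X → X) (A : Set X) (x : X) : ℕ∞ :=
  ⨅ k ∈ {k : ℕ | 1 ≤ k ∧ T^[k] x ∈ A}, (k : ℕ∞)

/-- The shift map on one-sided sequences. -/
def shift (𝒜 : Type*) : (ℕ → 𝒜) → (ℕ → 𝒜) := fun x n => x (n + 1)

/-- The σ-algebra `ℱ_m^n` generated by the coordinates `m, …, n`. -/
def coordSigma (𝒜 : Type*) [m𝒜 : MeasurableSpace 𝒜] (m n : ℕ) :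
    MeasurableSpace (ℕ → 𝒜) :=
  ⨆ i ∈ Set.Icc m n, m𝒜.comap (fun x => x i)

/-- The α-mixing coefficient `α(g)`. -/
def alphaMix {𝒜 : Type*} [MeasurableSpace 𝒜] (μ : Measure (ℕ → 𝒜)) (g : ℕ) : ℝ :=
  ⨆ m : ℕ, ⨆ n : ℕ,
    ⨆ A : {A : Set (ℕ → 𝒜) // MeasurableSet[coordSigma 𝒜 0 n] A},
      ⨆ B : {B : Set (ℕ → 𝒜) // MeasurableSet[coordSigma 𝒜 (n + g) (m + g)] B},
        |(μ ((A : Set (ℕ → 𝒜)) ∩ B)).toReal - (μ A).toReal * (μ B).toReal|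


/-! ### Analytic part -/

/-- Pólya-type uniformity for antitone functions converging to `exp (-t)`. -/
lemma polya_exp (F : ℕ → ℝ → ℝ) (s : ℝ) (hs : 0 ≤ s)
    (hanti : ∀ n x y, s ≤ x → x ≤ y → F n y ≤ F n x)
    (hnn : ∀ n x, 0 ≤ F n x)
    (hlim : ∀ t, s ≤ t → Tendsto (fun n => F n t) atTop (𝓝 (Real.exp (-t)))) :
    Tendsto (fun n => ⨆ t : {t : ℝ // s ≤ t}, |F n t - Real.exp (-(t : ℝ))|) atTop (𝓝 0) := by
  rw [Metric.tendsto_atTop]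
  intro ε hε
  set h : ℝ := ε / 4 with hh
  have hh0 : 0 < h := by positivity
  obtain ⟨M, hM⟩ : ∃ M : ℕ, Real.exp (-(s + M * h)) ≤ h := by
    have : Tendsto (fun M : ℕ => Real.exp (-(s + M * h))) atTop (𝓝 0) := by
      refine Real.tendsto_exp_atBot.comp ?_
      refine tendsto_neg_atTop_atBot.comp ?_
      exact tendsto_atTop_add_const_left _ _
        (tendsto_natCast_atTop_atTop.atTop_mul_const hh0)
    exact ((this.eventually (ge_mem_nhds hh0))).exists
  have hgrid : ∀ᶠ n in atTop, ∀ j ∈ Finset.range (M + 1),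
      |F n (s + j * h) - Real.exp (-(s + j * h))| ≤ h := by
    rw [Filter.eventually_all_finset]
    intro j _
    have h1 := hlim (s + j * h) (by have : 0 ≤ (j : ℝ) * h := by positivity
                                    linarith)
    have h2 := (h1.sub_const (Real.exp (-(s + j * h)))).abs
    simp only [sub_self, abs_zero] at h2
    exact h2.eventually (ge_mem_nhds hh0)
  obtain ⟨n₀, hn₀⟩ := eventually_atTop.1 hgrid
  refine ⟨n₀, fun n hn => ?_⟩
  have hg := hn₀ n hn
  have hlip : ∀ x y : ℝ, 0 ≤ x → x ≤ y → Real.exp (-x) ≤ Real.exp (-y) + (y - x) := by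
    intro x y hx hxy
    have e1 : Real.exp (-y) = Real.exp (-x) * Real.exp (-(y - x)) := by
      rw [← Real.exp_add]; congr 1; ring
    have e2 : 1 - (y - x) ≤ Real.exp (-(y - x)) := by
      have := Real.add_one_le_exp (-(y - x)); linarith
    have e3 : Real.exp (-x) ≤ 1 := Real.exp_le_one_iff.2 (by linarith)
    have e4 : 0 < Real.exp (-x) := Real.exp_pos _
    nlinarith
  have key : (⨆ t : {t : ℝ // s ≤ t}, |F n t - Real.exp (-(t : ℝ))|) ≤ 2 * h := by
    refine Real.iSup_le ?_ (by positivity)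
    rintro ⟨t, ht⟩
    simp only
    by_cases htM : s + M * h ≤ t
    · have g1 := abs_le.1 (hg M (by simp))
      have a0 : 0 ≤ (M : ℝ) * h := by positivity
      have g2 := hanti n _ _ (by linarith) htM
      have g3 := hnn n t
      have g4 : Real.exp (-t) ≤ Real.exp (-(s + M * h)) := Real.exp_le_exp.2 (by linarith)
      have g5 := Real.exp_pos (-t)
      rw [abs_le]; constructor <;> linarith [g1.1, g1.2]
    · push Not at htM
      set j := ⌊(t - s) / h⌋₊ with hj
      have q0 : 0 ≤ (t - s) / h := div_nonneg (by linarith) hh0.le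
      have j1 : (j : ℝ) * h ≤ t - s := by
        rw [← le_div_iff₀ hh0]; exact Nat.floor_le q0
      have j2 : t - s < ((j + 1 : ℕ) : ℝ) * h := by
        rw [← div_lt_iff₀ hh0]; push_cast; exact Nat.lt_floor_add_one _
      have jM : j < M := by
        have : (j : ℝ) * h < M * h := by linarith
        exact_mod_cast lt_of_mul_lt_mul_right this hh0.le
      have g1 := abs_le.1 (hg j (by simp; omega))
      have g2 := abs_le.1 (hg (j + 1) (by simp; omega))
      have a0 : 0 ≤ (j : ℝ) * h := by positivity
      have g3 := hanti n (s + j * h) t (by linarith) (by linarith)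
      have g4 := hanti n t (s + (j + 1 : ℕ) * h) (by linarith) (by linarith)
      have g5 := hlip (s + j * h) t (by linarith) (by linarith)
      have g6 := hlip t (s + (j + 1 : ℕ) * h) (by linarith) (by linarith)
      have g7 : ((j + 1 : ℕ) : ℝ) * h = j * h + h := by push_cast; ring
      rw [abs_le]; constructor <;> linarith [g1.1, g1.2, g2.1, g2.2]
  have key0 : 0 ≤ (⨆ t : {t : ℝ // s ≤ t}, |F n t - Real.exp (-(t : ℝ))|) :=
    Real.iSup_nonneg fun _ => abs_nonneg _
  rw [Real.dist_eq, sub_zero, abs_of_nonneg key0]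
  linarith

/-- Approximately multiplicative antitone functions with `F 1 → e⁻¹` converge to `exp (-t)`. -/
lemma approx_mul_exp (F : ℕ → ℝ → ℝ) (δ : ℕ → ℝ)
    (hanti : ∀ n x y, 0 ≤ x → x ≤ y → F n y ≤ F n x)
    (hnn : ∀ n x, 0 ≤ F n x) (h1 : ∀ n x, F n x ≤ 1) (h0 : ∀ n, F n 0 = 1)
    (hmul : ∀ n x y, 0 ≤ x → 0 ≤ y → |F n (x + y) - F n x * F n y| ≤ δ n)
    (hδ : Tendsto δ atTop (𝓝 0))
    (hone : Tendsto (fun n => F n 1) atTop (𝓝 (Real.exp (-1)))) (t : ℝ) (ht : 0 ≤ t) :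
    Tendsto (fun n => F n t) atTop (𝓝 (Real.exp (-t))) := by
  have hpow : ∀ (x : ℝ), 0 ≤ x → ∀ p : ℕ,
      Tendsto (fun n => F n (p * x) - F n x ^ p) atTop (𝓝 0) := by
    intro x hx p
    induction p with
    | zero => simp [h0]
    | succ p ih =>
      have e1 : Tendsto (fun n => F n (p * x + x) - F n (p * x) * F n x) atTop (𝓝 0) :=
        squeeze_zero_norm (fun n => by
          rw [Real.norm_eq_abs]; exact hmul n _ _ (by positivity) hx) hδ
      have e2 : Tendsto (fun n => (F n (p * x) - F n x ^ p) * F n x) atTop (𝓝 0) := by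
        refine squeeze_zero_norm (fun n => ?_) ((tendsto_zero_iff_norm_tendsto_zero).1 ih)
        rw [norm_mul]
        refine mul_le_of_le_one_right (norm_nonneg _) ?_
        rw [Real.norm_eq_abs, abs_of_nonneg (hnn _ _)]; exact h1 _ _
      have e3 := e1.add e2
      simp only [add_zero] at e3
      refine e3.congr fun n => ?_
      have : ((p + 1 : ℕ) : ℝ) * x = p * x + x := by push_cast; ring
      rw [this, pow_succ]; ring
  have hrat : ∀ (p q : ℕ), 0 < q →
      Tendsto (fun n => F n (p * (1 / q : ℝ))) atTop (𝓝 (Real.exp (-(p * (1 / q : ℝ))))) := by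
    intro p q hq
    have hq' : (0 : ℝ) < q := by exact_mod_cast hq
    have a1 := hpow (1 / q : ℝ) (by positivity) q
    have a2 : Tendsto (fun n => F n (1 / q : ℝ) ^ q) atTop (𝓝 (Real.exp (-1))) := by
      have := hone.sub a1
      simp only [sub_zero] at this
      refine this.congr fun n => ?_
      rw [mul_one_div_cancel hq'.ne']; ring
    have a3 : Tendsto (fun n => F n (1 / q : ℝ)) atTop (𝓝 (Real.exp (-(1 / q : ℝ)))) := by
      have := a2.rpow_const (p := (q : ℝ)⁻¹) (Or.inl (Real.exp_pos _).ne')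
      rw [← Real.exp_mul] at this
      have e : (-1 : ℝ) * (q : ℝ)⁻¹ = -(1 / q : ℝ) := by ring
      rw [e] at this
      refine this.congr fun n => ?_
      exact Real.pow_rpow_inv_natCast (hnn _ _) hq.ne'
    have a4 := (hpow (1 / q : ℝ) (by positivity) p).add (a3.pow p)
    simp only [zero_add, sub_add_cancel] at a4
    rw [← Real.exp_nat_mul] at a4
    convert a4 using 2
    ring_nf
  rw [Metric.tendsto_atTop]
  intro ε hε
  obtain ⟨q', hq'⟩ := exists_nat_gt (2 / ε)
  set q : ℕ := q' + 1
  have hq : (0 : ℝ) < q := by positivity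
  have hqε : (1 / q : ℝ) < ε / 2 := by
    rw [div_lt_iff₀ hq]
    rw [div_lt_iff₀ hε] at hq'
    have : (q : ℝ) = q' + 1 := by simp [q]
    rw [this]; nlinarith
  set p := ⌊t * q⌋₊ with hp
  have p1 : (p : ℝ) * (1 / q) ≤ t := by
    rw [mul_one_div, div_le_iff₀ hq]; exact Nat.floor_le (by positivity)
  have p2 : t ≤ ((p + 1 : ℕ) : ℝ) * (1 / q) := by
    rw [mul_one_div, le_div_iff₀ hq]; push_cast; exact (Nat.lt_floor_add_one _).le
  have p3 : ((p + 1 : ℕ) : ℝ) * (1 / q) = p * (1 / q) + 1 / q := by push_cast; ring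
  have hlip : ∀ x y : ℝ, 0 ≤ x → x ≤ y → Real.exp (-x) ≤ Real.exp (-y) + (y - x) := by
    intro x y hx hxy
    have e1 : Real.exp (-y) = Real.exp (-x) * Real.exp (-(y - x)) := by
      rw [← Real.exp_add]; congr 1; ring
    have e2 : 1 - (y - x) ≤ Real.exp (-(y - x)) := by
      have := Real.add_one_le_exp (-(y - x)); linarith
    have e3 : Real.exp (-x) ≤ 1 := Real.exp_le_one_iff.2 (by linarith)
    have e4 : 0 < Real.exp (-x) := Real.exp_pos _
    nlinarith
  obtain ⟨n1, hn1⟩ := Metric.tendsto_atTop.1 (hrat p q (by positivity)) (ε / 2) (by positivity)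
  obtain ⟨n2, hn2⟩ := Metric.tendsto_atTop.1 (hrat (p + 1) q (by positivity)) (ε / 2)
    (by positivity)
  refine ⟨max n1 n2, fun n hn => ?_⟩
  have b1 := hn1 n (le_trans (le_max_left _ _) hn)
  have b2 := hn2 n (le_trans (le_max_right _ _) hn)
  rw [Real.dist_eq, abs_lt] at b1 b2 ⊢
  have pp : 0 ≤ (p : ℝ) * (1 / q) := by positivity
  have c1 := hanti n _ _ pp p1
  have c2 := hanti n _ _ ht p2
  have d1 := hlip _ _ pp p1
  have d2 := hlip _ _ ht p2
  constructor <;> linarith [b1.1, b1.2, b2.1, b2.2]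

/-- Derivative of convex functions converges. -/
lemma convex_deriv_exp (F R : ℕ → ℝ → ℝ) (a : ℕ → ℝ) (ha : Tendsto a atTop (𝓝 0))
    (hup : ∀ n t h, 0 < h → h ≤ t → h * R n t ≤ F n (t - h) - F n t + a n)
    (hlo : ∀ n t h, 0 < h → 0 ≤ t → F n t - F n (t + h) - a n ≤ h * R n t)
    (hF : ∀ t, 0 ≤ t → Tendsto (fun n => F n t) atTop (𝓝 (Real.exp (-t))))
    (t : ℝ) (ht : 0 < t) : Tendsto (fun n => R n t) atTop (𝓝 (Real.exp (-t))) := by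
  rw [Metric.tendsto_atTop]
  intro ε hε
  set h : ℝ := min (min 1 t) (ε / 2) with hh
  have hh0 : 0 < h := by simp only [hh, lt_min_iff]; exact ⟨⟨one_pos, ht⟩, by positivity⟩
  have hh1 : h ≤ 1 := (min_le_left _ _).trans (min_le_left _ _)
  have hht : h ≤ t := (min_le_left _ _).trans (min_le_right _ _)
  have hhε : h ≤ ε / 2 := min_le_right _ _
  have u := ((hF (t - h) (by linarith)).sub (hF t ht.le)).add ha
  have l := ((hF t ht.le).sub (hF (t + h) (by linarith))).sub ha
  have hη : 0 < h * (ε / 2) := by positivity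
  obtain ⟨n1, hn1⟩ := Metric.tendsto_atTop.1 u _ hη
  obtain ⟨n2, hn2⟩ := Metric.tendsto_atTop.1 l _ hη
  refine ⟨max n1 n2, fun n hn => ?_⟩
  have b1 := hn1 n (le_trans (le_max_left _ _) hn)
  have b2 := hn2 n (le_trans (le_max_right _ _) hn)
  have c1 := hup n t h hh0 hht
  have c2 := hlo n t h hh0 ht.le
  rw [Real.dist_eq, abs_lt] at b1 b2 ⊢
  have e1 : Real.exp (-(t - h)) = Real.exp (-t) * Real.exp h := by
    rw [← Real.exp_add]; congr 1; ring
  have e2 : Real.exp (-(t + h)) = Real.exp (-t) * Real.exp (-h) := by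
    rw [← Real.exp_add]; congr 1; ring
  have f1 := abs_le.1 (Real.abs_exp_sub_one_sub_id_le (x := h) (by rw [abs_of_pos hh0]; exact hh1))
  have f2 := abs_le.1 (Real.abs_exp_sub_one_sub_id_le (x := -h)
    (by rw [abs_neg, abs_of_pos hh0]; exact hh1))
  have E1 : Real.exp (-t) ≤ 1 := Real.exp_le_one_iff.2 (by linarith)
  have E0 := Real.exp_pos (-t)
  have g1 : Real.exp (-t) * Real.exp h ≤ Real.exp (-t) + h * Real.exp (-t) + h * h := by
    have : Real.exp (-t) * Real.exp h ≤ Real.exp (-t) * (1 + h + h ^ 2) :=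
      mul_le_mul_of_nonneg_left (by linarith [f1.2]) E0.le
    nlinarith
  have g2 : Real.exp (-t) * Real.exp (-h) ≤ Real.exp (-t) - h * Real.exp (-t) + h * h := by
    have : Real.exp (-t) * Real.exp (-h) ≤ Real.exp (-t) * (1 - h + h ^ 2) :=
      mul_le_mul_of_nonneg_left (by nlinarith [f2.2]) E0.le
    nlinarith
  rw [e1] at b1
  rw [e2] at b2
  have hhh : h * h ≤ h * (ε / 2) := mul_le_mul_of_nonneg_left hhε hh0.le
  constructor
  · have : h * (-ε) < h * (R n t - Real.exp (-t)) := by nlinarith [b2.1]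
    exact lt_of_mul_lt_mul_left this hh0.le
  · have : h * (R n t - Real.exp (-t)) < h * ε := by nlinarith [b1.2]
    exact lt_of_mul_lt_mul_left this hh0.le

/-! ### Measure-theoretic part -/

/-- No visit to `A` during times `1, …, k`. -/
def noHit (𝒜 : Type*) (A : Set (ℕ → 𝒜)) (k : ℕ) : Set (ℕ → 𝒜) :=
  {x | ∀ j, 1 ≤ j → j ≤ k → (shift 𝒜)^[j] x ∉ A}

lemma lt_hitTime_iff {𝒜 : Type*} (A : Set (ℕ → 𝒜)) (k : ℕ) (x : ℕ → 𝒜) :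
    (k : ℕ∞) < hitTime (shift 𝒜) A x ↔ x ∈ noHit 𝒜 A k := by
  rw [← ENat.add_one_le_iff (ENat.coe_ne_top k)]
  unfold hitTime noHit
  rw [le_iInf₂_iff]
  simp only [mem_setOf_eq]
  constructor
  · intro h j h1 hk hj
    have := h j ⟨h1, hj⟩
    have : k + 1 ≤ j := by exact_mod_cast this
    omega
  · rintro h j ⟨h1, hj⟩
    by_contra hc
    have : ¬ (k + 1 ≤ j) := fun h' => hc (by exact_mod_cast h')
    exact h j h1 (by omega) hj

lemma noHit_zero {𝒜 : Type*} (A : Set (ℕ → 𝒜)) : noHit 𝒜 A 0 = univ := by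
  ext x; simp only [noHit, mem_setOf_eq, mem_univ, iff_true]; intro j h1 h2; omega

lemma noHit_add {𝒜 : Type*} (A : Set (ℕ → 𝒜)) (i j : ℕ) :
    noHit 𝒜 A (i + j) = noHit 𝒜 A i ∩ (shift 𝒜)^[i] ⁻¹' noHit 𝒜 A j := by
  ext x
  simp only [noHit, mem_setOf_eq, mem_inter_iff, mem_preimage, ← Function.iterate_add_apply]
  constructor
  · intro h
    exact ⟨fun l h1 h2 => h l h1 (by omega), fun l h1 h2 => h (l + i) (by omega) (by omega)⟩
  · rintro ⟨h, h'⟩ l h1 h2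
    by_cases hl : l ≤ i
    · exact h l h1 hl
    · have := h' (l - i) (by omega) (by omega)
      rwa [Nat.sub_add_cancel (by omega)] at this

lemma noHit_succ {𝒜 : Type*} (A : Set (ℕ → 𝒜)) (k : ℕ) :
    noHit 𝒜 A (k + 1) = shift 𝒜 ⁻¹' (noHit 𝒜 A k \ A) := by
  ext x
  simp only [noHit, mem_setOf_eq, mem_preimage, mem_diff, ← Function.iterate_succ_apply]
  constructor
  · intro h
    exact ⟨fun l h1 h2 => h (l + 1) (by omega) (by omega), h 1 le_rfl (by omega)⟩
  · rintro ⟨h, h'⟩ l h1 h2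
    obtain rfl | hl := eq_or_ne l 1
    · exact h'
    · have := h (l - 1) (by omega) (by omega)
      rwa [Nat.succ_eq_add_one, Nat.sub_add_cancel (by omega)] at this

lemma coordSigma_le {𝒜 : Type*} [MeasurableSpace 𝒜] (m n : ℕ) :
    coordSigma 𝒜 m n ≤ MeasurableSpace.pi := by
  unfold coordSigma
  refine iSup₂_le fun i _ => ?_
  exact (measurable_pi_apply i).comap_le

lemma coordSigma_mono {𝒜 : Type*} [MeasurableSpace 𝒜] {m n m' n' : ℕ} (h : m' ≤ m)
    (h' : n ≤ n') : coordSigma 𝒜 m n ≤ coordSigma 𝒜 m' n' := by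
  unfold coordSigma
  exact biSup_mono fun i hi => ⟨h.trans hi.1, hi.2.trans h'⟩

lemma shift_iterate {𝒜 : Type*} (p : ℕ) (x : ℕ → 𝒜) (i : ℕ) :
    (shift 𝒜)^[p] x i = x (i + p) := by
  induction p generalizing x with
  | zero => rfl
  | succ p ih => rw [Function.iterate_succ_apply, ih]; rfl

lemma coordSigma_preimage {𝒜 : Type*} [MeasurableSpace 𝒜] (m n p : ℕ) (S : Set (ℕ → 𝒜))
    (hS : MeasurableSet[coordSigma 𝒜 m n] S) :
    MeasurableSet[coordSigma 𝒜 (m + p) (n + p)] ((shift 𝒜)^[p] ⁻¹' S) := by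
  have : (coordSigma 𝒜 m n).comap ((shift 𝒜)^[p]) ≤ coordSigma 𝒜 (m + p) (n + p) := by
    unfold coordSigma
    simp only [MeasurableSpace.comap_iSup, MeasurableSpace.comap_comp]
    refine iSup₂_le fun i hi => ?_
    have e : (fun x : ℕ → 𝒜 => x i) ∘ (shift 𝒜)^[p] = fun x => x (i + p) := by
      funext x; exact shift_iterate p x i
    rw [e]
    exact le_iSup₂_of_le (i + p) ⟨Nat.add_le_add_right hi.1 p, Nat.add_le_add_right hi.2 p⟩ le_rfl
  exact this _ ⟨S, hS, rfl⟩

lemma noHit_meas {𝒜 : Type*} [MeasurableSpace 𝒜] (A : Set (ℕ → 𝒜)) (N : ℕ)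
    (hA : MeasurableSet[coordSigma 𝒜 0 N] A) (k : ℕ) :
    MeasurableSet[coordSigma 𝒜 0 (N + k)] (noHit 𝒜 A k) := by
  induction k with
  | zero => rw [noHit_zero]; exact MeasurableSet.univ
  | succ k ih =>
    rw [noHit_succ]
    have h1 : MeasurableSet[coordSigma 𝒜 0 (N + k)] (noHit 𝒜 A k \ A) :=
      MeasurableSet.diff ih (coordSigma_mono le_rfl (by omega) _ hA)
    have := coordSigma_preimage 0 (N + k) 1 _ h1
    exact coordSigma_mono (by omega) (by omega) _ this

lemma alphaMix_bound {𝒜 : Type*} [MeasurableSpace 𝒜] (μ : Measure (ℕ → 𝒜))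
    [IsProbabilityMeasure μ] (g m n : ℕ) (A B : Set (ℕ → 𝒜))
    (hA : MeasurableSet[coordSigma 𝒜 0 n] A)
    (hB : MeasurableSet[coordSigma 𝒜 (n + g) (m + g)] B) :
    |μ.real (A ∩ B) - μ.real A * μ.real B| ≤ alphaMix μ g := by
  have hb : ∀ S T : Set (ℕ → 𝒜),
      |(μ (S ∩ T)).toReal - (μ S).toReal * (μ T).toReal| ≤ 1 := by
    intro S T
    change |μ.real (S ∩ T) - μ.real S * μ.real T| ≤ 1
    have h1 : μ.real (S ∩ T) ≤ 1 := measureReal_le_one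
    have h2 : μ.real S ≤ 1 := measureReal_le_one
    have h3 : μ.real T ≤ 1 := measureReal_le_one
    have h4 : 0 ≤ μ.real (S ∩ T) := measureReal_nonneg
    have h5 : 0 ≤ μ.real S := measureReal_nonneg
    have h6 : 0 ≤ μ.real T := measureReal_nonneg
    have h7 : μ.real S * μ.real T ≤ 1 := mul_le_one₀ h2 h6 h3
    have h8 : 0 ≤ μ.real S * μ.real T := mul_nonneg h5 h6
    rw [abs_le]; constructor <;> linarith
  unfold alphaMix
  refine le_ciSup_of_le ⟨1, ?_⟩ m ?_
  · rintro _ ⟨m', rfl⟩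
    refine Real.iSup_le (fun n' => Real.iSup_le (fun A' => Real.iSup_le (fun B' => ?_) ?_) ?_) ?_
      <;> first | exact hb _ _ | norm_num
  refine le_ciSup_of_le ⟨1, ?_⟩ n ?_
  · rintro _ ⟨n', rfl⟩
    refine Real.iSup_le (fun A' => Real.iSup_le (fun B' => ?_) ?_) ?_
      <;> first | exact hb _ _ | norm_num
  refine le_ciSup_of_le ⟨1, ?_⟩ ⟨A, hA⟩ ?_
  · rintro _ ⟨A', rfl⟩
    refine Real.iSup_le (fun B' => ?_) ?_ <;> first | exact hb _ _ | norm_num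
  refine le_ciSup_of_le ⟨1, ?_⟩ ⟨B, hB⟩ ?_
  · rintro _ ⟨B', rfl⟩
    exact hb _ _
  exact le_rfl

lemma noHit_measurable {𝒜 : Type*} [MeasurableSpace 𝒜]
    (A : Set (ℕ → 𝒜)) (N : ℕ)
    (hA : MeasurableSet[coordSigma 𝒜 0 N] A) (k : ℕ) : MeasurableSet (noHit 𝒜 A k) :=
  coordSigma_le _ _ _ (noHit_meas A N hA k)

lemma G_succ {𝒜 : Type*} [MeasurableSpace 𝒜] (μ : Measure (ℕ → 𝒜)) [IsProbabilityMeasure μ]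
    (hT : MeasurePreserving (shift 𝒜) μ μ) (A : Set (ℕ → 𝒜)) (N : ℕ)
    (hA : MeasurableSet[coordSigma 𝒜 0 N] A)
    (k : ℕ) :
    μ.real (noHit 𝒜 A k) - μ.real (noHit 𝒜 A (k + 1)) = μ.real (A ∩ noHit 𝒜 A k) := by
  have hm := noHit_measurable A N hA k
  have hA' : MeasurableSet A := coordSigma_le _ _ _ hA
  rw [noHit_succ, hT.measureReal_preimage (hm.diff hA').nullMeasurableSet]
  have := measureReal_inter_add_diff (μ := μ) (s := noHit 𝒜 A k) hA'
  rw [inter_comm A]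
  linarith

lemma G_add_ge {𝒜 : Type*} [MeasurableSpace 𝒜] (μ : Measure (ℕ → 𝒜)) [IsProbabilityMeasure μ]
    (hT : MeasurePreserving (shift 𝒜) μ μ) (A : Set (ℕ → 𝒜)) (N : ℕ)
    (hA : MeasurableSet[coordSigma 𝒜 0 N] A)
    (i j : ℕ) :
    μ.real (noHit 𝒜 A i) + μ.real (noHit 𝒜 A j) - 1 ≤ μ.real (noHit 𝒜 A (i + j)) := by
  have hm := noHit_measurable A N hA j
  have hm' := (hT.iterate i).measurable hm
  rw [noHit_add]
  have h1 := measureReal_inter_add_diff (μ := μ) (s := noHit 𝒜 A i) hm'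
  have h2 : μ.real (noHit 𝒜 A i \ (shift 𝒜)^[i] ⁻¹' noHit 𝒜 A j) ≤
      μ.real ((shift 𝒜)^[i] ⁻¹' noHit 𝒜 A j)ᶜ := measureReal_mono (fun x hx => hx.2)
  rw [probReal_compl_eq_one_sub hm',
    (hT.iterate i).measureReal_preimage hm.nullMeasurableSet] at h2
  linarith

lemma noHit_anti {𝒜 : Type*} (A : Set (ℕ → 𝒜))
    {i j : ℕ} (h : i ≤ j) : noHit 𝒜 A j ⊆ noHit 𝒜 A i :=
  fun _ hx l h1 h2 => hx l h1 (h2.trans h)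

lemma G_anti {𝒜 : Type*} [MeasurableSpace 𝒜] (μ : Measure (ℕ → 𝒜)) [IsProbabilityMeasure μ] (A : Set (ℕ → 𝒜))
    {i j : ℕ} (h : i ≤ j) : μ.real (noHit 𝒜 A j) ≤ μ.real (noHit 𝒜 A i) :=
  measureReal_mono (noHit_anti A h)

lemma G_gap {𝒜 : Type*} [MeasurableSpace 𝒜] (μ : Measure (ℕ → 𝒜)) [IsProbabilityMeasure μ]
    (hT : MeasurePreserving (shift 𝒜) μ μ) (A : Set (ℕ → 𝒜)) (N : ℕ)
    (hA : MeasurableSet[coordSigma 𝒜 0 N] A)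
    (g i j : ℕ) :
    |μ.real (noHit 𝒜 A i ∩ (shift 𝒜)^[i + (N + g)] ⁻¹' noHit 𝒜 A j) -
      μ.real (noHit 𝒜 A i) * μ.real (noHit 𝒜 A j)| ≤ alphaMix μ g := by
  have h1 := noHit_meas A N hA i
  have h2 := coordSigma_preimage 0 (N + j) (i + (N + g)) _ (noHit_meas A N hA j)
  have := alphaMix_bound μ g (N + j + i + N) (N + i) _ ((shift 𝒜)^[i + (N + g)] ⁻¹' noHit 𝒜 A j)
    h1 (coordSigma_mono (by omega) (by omega) _ h2)
  rwa [(hT.iterate _).measureReal_preimage (noHit_measurable A N hA j).nullMeasurableSet] at this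

lemma G_gap_le {𝒜 : Type*} [MeasurableSpace 𝒜] (μ : Measure (ℕ → 𝒜)) [IsProbabilityMeasure μ]
    (hT : MeasurePreserving (shift 𝒜) μ μ) (A : Set (ℕ → 𝒜)) (N : ℕ)
    (hA : MeasurableSet[coordSigma 𝒜 0 N] A)
    (g i j : ℕ) :
    μ.real (noHit 𝒜 A (i + (N + g) + j)) ≤
      μ.real (noHit 𝒜 A i ∩ (shift 𝒜)^[i + (N + g)] ⁻¹' noHit 𝒜 A j) := by
  refine measureReal_mono ?_
  rw [noHit_add]
  exact inter_subset_inter_left _ (noHit_anti A (by omega))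

lemma G_gap_ge {𝒜 : Type*} [MeasurableSpace 𝒜] (μ : Measure (ℕ → 𝒜)) [IsProbabilityMeasure μ]
    (hT : MeasurePreserving (shift 𝒜) μ μ) (A : Set (ℕ → 𝒜)) (N : ℕ)
    (hA : MeasurableSet[coordSigma 𝒜 0 N] A)
    (g i j : ℕ) :
    μ.real (noHit 𝒜 A i ∩ (shift 𝒜)^[i + (N + g)] ⁻¹' noHit 𝒜 A j) -
      (1 - μ.real (noHit 𝒜 A (N + g))) ≤ μ.real (noHit 𝒜 A (i + (N + g) + j)) := by
  have hm := noHit_measurable A N hA (N + g)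
  have hm' := (hT.iterate i).measurable hm
  have h1 := measureReal_inter_add_diff (μ := μ)
    (s := noHit 𝒜 A i ∩ (shift 𝒜)^[i + (N + g)] ⁻¹' noHit 𝒜 A j) hm'
  have h2 : μ.real ((noHit 𝒜 A i ∩ (shift 𝒜)^[i + (N + g)] ⁻¹' noHit 𝒜 A j) \
      (shift 𝒜)^[i] ⁻¹' noHit 𝒜 A (N + g)) ≤
      μ.real ((shift 𝒜)^[i] ⁻¹' noHit 𝒜 A (N + g))ᶜ := measureReal_mono (fun x hx => hx.2)
  rw [probReal_compl_eq_one_sub hm',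
    (hT.iterate i).measureReal_preimage hm.nullMeasurableSet] at h2
  have h3 : (noHit 𝒜 A i ∩ (shift 𝒜)^[i + (N + g)] ⁻¹' noHit 𝒜 A j) ∩
      (shift 𝒜)^[i] ⁻¹' noHit 𝒜 A (N + g) = noHit 𝒜 A (i + (N + g) + j) := by
    rw [noHit_add A (i + (N + g)), noHit_add A i, inter_right_comm]
  rw [h3] at h1
  linarith

lemma G_mul {𝒜 : Type*} [MeasurableSpace 𝒜] (μ : Measure (ℕ → 𝒜)) [IsProbabilityMeasure μ]
    (hT : MeasurePreserving (shift 𝒜) μ μ) (A : Set (ℕ → 𝒜)) (N : ℕ)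
    (hA : MeasurableSet[coordSigma 𝒜 0 N] A)
    (g i j : ℕ) :
    |μ.real (noHit 𝒜 A (i + j)) - μ.real (noHit 𝒜 A i) * μ.real (noHit 𝒜 A j)| ≤
      alphaMix μ g + 2 * (1 - μ.real (noHit 𝒜 A (N + g))) := by
  have hα : 0 ≤ alphaMix μ g := (abs_nonneg _).trans (G_gap μ hT A N hA g 0 0)
  have hi1 : μ.real (noHit 𝒜 A i) ≤ 1 := measureReal_le_one
  have hi0 : 0 ≤ μ.real (noHit 𝒜 A i) := measureReal_nonneg
  have hj1 : μ.real (noHit 𝒜 A j) ≤ 1 := measureReal_le_one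
  have hD1 : μ.real (noHit 𝒜 A (N + g)) ≤ 1 := measureReal_le_one
  by_cases hj : j < N + g
  · have h1 := G_add_ge μ hT A N hA i j
    have h2 := G_anti μ A (show i ≤ i + j by omega)
    have h3 := G_anti μ A hj.le
    rw [abs_le]; constructor <;> nlinarith
  · obtain ⟨l, rfl⟩ : ∃ l, j = l + (N + g) := ⟨j - (N + g), by omega⟩
    have h1 := abs_le.1 (G_gap μ hT A N hA g i l)
    have h2 := G_gap_le μ hT A N hA g i l
    have h3 := G_gap_ge μ hT A N hA g i l
    have h4 := G_add_ge μ hT A N hA l (N + g)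
    have h5 := G_anti μ A (show l ≤ l + (N + g) by omega)
    have e : i + (l + (N + g)) = i + (N + g) + l := by omega
    rw [e]
    rw [abs_le]; constructor <;> nlinarith [h1.1, h1.2]

lemma G_tendsto {𝒜 : Type*} [MeasurableSpace 𝒜] (μ : Measure (ℕ → 𝒜)) [IsProbabilityMeasure μ]
    (hT : MeasurePreserving (shift 𝒜) μ μ) (A : Set (ℕ → 𝒜)) (N : ℕ)
    (hA : MeasurableSet[coordSigma 𝒜 0 N] A)
    (hmix : Tendsto (alphaMix μ) atTop (𝓝 0)) (hpos : 0 < μ.real A) :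
    Tendsto (fun k => μ.real (noHit 𝒜 A k)) atTop (𝓝 0) := by
  have hanti : Antitone (fun k => μ.real (noHit 𝒜 A k)) := fun i j h => G_anti μ A h
  have hbdd : BddBelow (range fun k => μ.real (noHit 𝒜 A k)) :=
    ⟨0, by rintro _ ⟨k, rfl⟩; exact measureReal_nonneg⟩
  have hlim := tendsto_atTop_ciInf hanti hbdd
  set c := ⨅ k, μ.real (noHit 𝒜 A k) with hc
  have hc0 : 0 ≤ c := le_ciInf fun k => measureReal_nonneg
  have hck : ∀ k, c ≤ μ.real (noHit 𝒜 A k) := fun k => ciInf_le hbdd k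
  have hc1 : c < 1 := by
    have h1 := G_succ μ hT A N hA 0
    rw [noHit_zero, inter_univ, probReal_univ] at h1
    have := hck (0 + 1)
    linarith
  have h1 : ∀ g, c ≤ alphaMix μ g + c * c := by
    intro g
    refine ge_of_tendsto' ((hlim.mul hlim).const_add (alphaMix μ g)) fun i => ?_
    have h1 := abs_le.1 (G_gap μ hT A N hA g i i)
    have h2 := G_gap_le μ hT A N hA g i i
    have h3 := hck (i + (N + g) + i)
    linarith [h1.2]
  have h2 : c ≤ 0 + c * c := ge_of_tendsto' (hmix.add_const _) h1
  have : c = 0 := by nlinarith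
  rwa [this] at hlim

lemma G_ge_linear {𝒜 : Type*} [MeasurableSpace 𝒜] (μ : Measure (ℕ → 𝒜)) [IsProbabilityMeasure μ]
    (hT : MeasurePreserving (shift 𝒜) μ μ) (A : Set (ℕ → 𝒜)) (N : ℕ)
    (hA : MeasurableSet[coordSigma 𝒜 0 N] A)
    (k : ℕ) : 1 - k * μ.real A ≤ μ.real (noHit 𝒜 A k) := by
  induction k with
  | zero => simp [noHit_zero]
  | succ k ih =>
    have h1 := G_succ μ hT A N hA k
    have h2 : μ.real (A ∩ noHit 𝒜 A k) ≤ μ.real A := measureReal_mono inter_subset_left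
    push_cast
    linarith

/-- The scale: first time when the survival function falls below `e⁻¹`. -/
lemma exists_scale {𝒜 : Type*} [MeasurableSpace 𝒜] (μ : Measure (ℕ → 𝒜)) [IsProbabilityMeasure μ]
    (hT : MeasurePreserving (shift 𝒜) μ μ) (A : Set (ℕ → 𝒜)) (N : ℕ)
    (hA : MeasurableSet[coordSigma 𝒜 0 N] A)
    (hmix : Tendsto (alphaMix μ) atTop (𝓝 0)) (hpos : 0 < μ.real A) :
    ∃ K : ℕ, 0 < K ∧ μ.real (noHit 𝒜 A K) ≤ Real.exp (-1) ∧
      Real.exp (-1) - μ.real A ≤ μ.real (noHit 𝒜 A K) ∧ 1 / 2 ≤ K * μ.real A := by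
  classical
  have hex : ∃ k, μ.real (noHit 𝒜 A k) ≤ Real.exp (-1) :=
    ((G_tendsto μ hT A N hA hmix hpos).eventually (ge_mem_nhds (Real.exp_pos _))).exists
  have hspec := Nat.find_spec hex
  have hmin := fun m => Nat.find_min hex (m := m)
  set K := Nat.find hex
  have he : Real.exp (-1) ≤ 1 / 2 := by
    rw [Real.exp_neg, one_div]
    exact inv_anti₀ (by norm_num) (by have := Real.add_one_le_exp 1; linarith)
  have hK : 0 < K := by
    rcases Nat.eq_zero_or_pos K with h | h
    · rw [h, noHit_zero, probReal_univ] at hspec; linarith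
    · exact h
  refine ⟨K, hK, hspec, ?_, ?_⟩
  · have h0 := hmin (K - 1) (by omega)
    have h1 := G_succ μ hT A N hA (K - 1)
    have h2 : μ.real (A ∩ noHit 𝒜 A (K - 1)) ≤ μ.real A := measureReal_mono inter_subset_left
    rw [Nat.sub_add_cancel hK] at h1
    linarith
  · have := G_ge_linear μ hT A N hA K
    linarith

lemma G_sum_le {𝒜 : Type*} [MeasurableSpace 𝒜] (μ : Measure (ℕ → 𝒜)) [IsProbabilityMeasure μ]
    (hT : MeasurePreserving (shift 𝒜) μ μ) (A : Set (ℕ → 𝒜)) (N : ℕ)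
    (hA : MeasurableSet[coordSigma 𝒜 0 N] A)
    (i l : ℕ) : μ.real (noHit 𝒜 A i) - μ.real (noHit 𝒜 A (i + l)) ≤
    l * μ.real (A ∩ noHit 𝒜 A i) := by
  induction l with
  | zero => simp
  | succ l ih =>
    have h1 := G_succ μ hT A N hA (i + l)
    have h2 : μ.real (A ∩ noHit 𝒜 A (i + l)) ≤ μ.real (A ∩ noHit 𝒜 A i) :=
      measureReal_mono (inter_subset_inter_right _ (noHit_anti A (by omega)))
    rw [← add_assoc]
    push_cast
    linarith

lemma G_sum_ge {𝒜 : Type*} [MeasurableSpace 𝒜] (μ : Measure (ℕ → 𝒜)) [IsProbabilityMeasure μ]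
    (hT : MeasurePreserving (shift 𝒜) μ μ) (A : Set (ℕ → 𝒜)) (N : ℕ)
    (hA : MeasurableSet[coordSigma 𝒜 0 N] A)
    (i l : ℕ) : l * μ.real (A ∩ noHit 𝒜 A (i + l)) ≤
    μ.real (noHit 𝒜 A i) - μ.real (noHit 𝒜 A (i + l)) := by
  induction l with
  | zero => simp
  | succ l ih =>
    have h1 := G_succ μ hT A N hA (i + l)
    have h2 : μ.real (A ∩ noHit 𝒜 A (i + (l + 1))) ≤ μ.real (A ∩ noHit 𝒜 A (i + l)) :=
      measureReal_mono (inter_subset_inter_right _ (noHit_anti A (by omega)))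
    have h3 : (l : ℝ) * μ.real (A ∩ noHit 𝒜 A (i + (l + 1))) ≤
      l * μ.real (A ∩ noHit 𝒜 A (i + l)) := mul_le_mul_of_nonneg_left h2 (by positivity)
    rw [← add_assoc] at h2 h3 ⊢
    push_cast
    linarith


lemma set_eq_noHit {𝒜 : Type*} (A : Set (ℕ → 𝒜)) (K : ℕ) (hK : 0 < K) (c : ℝ≥0∞)
    (hc : c = ENNReal.ofReal (1 / K)) (t : ℝ) (ht : 0 ≤ t) :
    {x | ENNReal.ofReal t < c * (hitTime (shift 𝒜) A x : ℝ≥0∞)} = noHit 𝒜 A ⌊t * K⌋₊ := by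
  ext x
  have hK' : (0 : ℝ) < K := by exact_mod_cast hK
  rw [← lt_hitTime_iff, mem_setOf_eq, hc]
  generalize hitTime (shift 𝒜) A x = τ
  induction τ with
  | top =>
    have : ENNReal.ofReal (1 / K) ≠ 0 := by
      rw [Ne, ENNReal.ofReal_eq_zero, not_le]; positivity
    simp only [ENat.toENNReal_top, ENNReal.mul_top this]
    simp
  | coe m =>
    rw [ENat.toENNReal_coe, ← ENNReal.ofReal_natCast m, ← ENNReal.ofReal_mul (by positivity),
      ENNReal.ofReal_lt_ofReal_iff_of_nonneg ht, Nat.cast_lt, Nat.floor_lt (by positivity),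
      one_div, inv_mul_eq_div, lt_div_iff₀ hK']

/-- **Return times of rare events are asymptotically exponential.**
For an α-mixing shift system and sets `A n ∈ ℱ_0^{n-1}` of positive measure with
`μ(τ_{A_n} ≤ n) → 0`, there are constants `lam n ∈ (0,2]` — the same ones which give the
exponential law for the rescaled hitting time — such that for every `s > 0`,
`sup_{t ≥ s} |lam(A_n)⁻¹ μ(lam(A_n)μ(A_n)τ_{A_n} > t | A_n) − e^{−t}| → 0`. -/
theorem return_time_exponential_law
    {𝒜 : Type*} [Countable 𝒜] [MeasurableSpace 𝒜] [DiscreteMeasurableSpace 𝒜]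
    (μ : Measure (ℕ → 𝒜)) [IsProbabilityMeasure μ]
    (hT : MeasurePreserving (shift 𝒜) μ μ)
    (hmix : Tendsto (alphaMix μ) atTop (𝓝 0))
    (A : ℕ → Set (ℕ → 𝒜))
    (hAmeas : ∀ n, MeasurableSet[coordSigma 𝒜 0 (n - 1)] (A n))
    (hApos : ∀ n, 0 < μ (A n))
    (hshort : Tendsto
      (fun n => (μ {x | hitTime (shift 𝒜) (A n) x ≤ (n : ℕ∞)}).toReal) atTop (𝓝 0)) :
    ∃ lam : ℕ → ℝ, (∀ n, lam n ∈ Set.Ioc (0 : ℝ) 2) ∧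
      -- the constants `lam` give the exponential law for the rescaled hitting time …
      Tendsto
        (fun n => ⨆ t : {t : ℝ // 0 ≤ t},
          |(μ {x | ENNReal.ofReal (t : ℝ) <
              ENNReal.ofReal (lam n) * μ (A n) *
                (hitTime (shift 𝒜) (A n) x : ℝ≥0∞)}).toReal -
            Real.exp (-(t : ℝ))|) atTop (𝓝 0) ∧
      -- … and the exponential law for the rescaled return time:
      ∀ s : ℝ, 0 < s →
        Tendsto
          (fun n => ⨆ t : {t : ℝ // s ≤ t},
            |(lam n)⁻¹ *
                (ProbabilityTheory.cond μ (A n)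
                  {x | ENNReal.ofReal (t : ℝ) <
                    ENNReal.ofReal (lam n) * μ (A n) *
                      (hitTime (shift 𝒜) (A n) x : ℝ≥0∞)}).toReal -
              Real.exp (-(t : ℝ))|) atTop (𝓝 0) := by
  have hApos' : ∀ n, 0 < μ.real (A n) := fun n =>
    ENNReal.toReal_pos (hApos n).ne' (measure_ne_top _ _)
  choose K hK hK1 hK2 hK3 using fun n =>
    exists_scale μ hT (A n) (n - 1) (hAmeas n) hmix (hApos' n)
  have hKr : ∀ n, (0 : ℝ) < K n := fun n => by exact_mod_cast hK n
  set a : ℕ → ℝ := fun n => μ.real (A n) with ha_def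
  set G : ℕ → ℕ → ℝ := fun n k => μ.real (noHit 𝒜 (A n) k) with hG
  set D : ℕ → ℕ → ℝ := fun n k => μ.real (A n ∩ noHit 𝒜 (A n) k) with hD
  -- short hits
  have hsh : Tendsto (fun n => 1 - G n n) atTop (𝓝 0) := by
    refine hshort.congr fun n => ?_
    have : {x | hitTime (shift 𝒜) (A n) x ≤ (n : ℕ∞)} = (noHit 𝒜 (A n) n)ᶜ := by
      ext x
      rw [mem_setOf_eq, mem_compl_iff, ← lt_hitTime_iff, not_lt]
    rw [this]
    exact probReal_compl_eq_one_sub (noHit_measurable (A n) (n - 1) (hAmeas n) n)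
  have hG0 : ∀ n, G n 0 = 1 := fun n => by simp [hG, noHit_zero]
  have hGanti : ∀ n {i j : ℕ}, i ≤ j → G n j ≤ G n i := fun n i j h => G_anti μ (A n) h
  have hGnn : ∀ n k, 0 ≤ G n k := fun n k => measureReal_nonneg
  have hG1 : ∀ n k, G n k ≤ 1 := fun n k => measureReal_le_one
  have hDa : ∀ n k, D n k ≤ a n := fun n k => measureReal_mono inter_subset_left
  have hDnn : ∀ n k, 0 ≤ D n k := fun n k => measureReal_nonneg
  have hDanti : ∀ n {i j : ℕ}, i ≤ j → D n j ≤ D n i := fun n i j h =>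
    measureReal_mono (inter_subset_inter_right _ (noHit_anti (A n) h))
  have hGD : ∀ n k, G n k - G n (k + 1) = D n k := fun n k =>
    G_succ μ hT (A n) (n - 1) (hAmeas n) k
  have hsle : ∀ n i l, G n i - G n (i + l) ≤ l * D n i := fun n i l =>
    G_sum_le μ hT (A n) (n - 1) (hAmeas n) i l
  have hsge : ∀ n i l, l * D n (i + l) ≤ G n i - G n (i + l) := fun n i l =>
    G_sum_ge μ hT (A n) (n - 1) (hAmeas n) i l
  have ha0 : Tendsto a atTop (𝓝 0) := by
    refine squeeze_zero' (Eventually.of_forall fun n => (hApos' n).le) ?_ hsh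
    filter_upwards [eventually_ge_atTop 1] with n hn
    have h1 := hGD n 0
    have h2 : D n 0 = a n := by simp [hD, noHit_zero, ha_def]
    have h3 := hGanti n hn
    rw [hG0, h2] at h1
    simp only [zero_add] at h1
    linarith
  set δ : ℕ → ℝ := fun n => alphaMix μ n + 4 * (1 - G n n) + a n with hδ
  have hδ0 : Tendsto δ atTop (𝓝 0) := by
    have := (hmix.add (hsh.const_mul 4)).add ha0
    simpa using this
  have hGmul : ∀ n i j, |G n (i + j) - G n i * G n j| ≤ alphaMix μ n + 4 * (1 - G n n) := by
    intro n i j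
    have h1 := G_mul μ hT (A n) (n - 1) (hAmeas n) n i j
    have h2 := G_add_ge μ hT (A n) (n - 1) (hAmeas n) n n
    have h3 := hGanti n (show n - 1 + n ≤ n + n by omega)
    refine h1.trans ?_
    simp only [hG] at h2 h3 ⊢
    linarith
  set F : ℕ → ℝ → ℝ := fun n t => G n ⌊t * K n⌋₊ with hF
  set R : ℕ → ℝ → ℝ := fun n t => K n * D n ⌊t * K n⌋₊ with hR
  have hfl : ∀ n (x y : ℝ), x ≤ y → ⌊x * K n⌋₊ ≤ ⌊y * K n⌋₊ := fun n x y h =>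
    Nat.floor_le_floor (mul_le_mul_of_nonneg_right h (hKr n).le)
  have hFlim : ∀ t, 0 ≤ t → Tendsto (fun n => F n t) atTop (𝓝 (Real.exp (-t))) := by
    refine fun t ht => approx_mul_exp F δ (fun n x y _ h => hGanti n (hfl n x y h))
      (fun n x => hGnn _ _) (fun n x => hG1 _ _) (fun n => by simp [hF, hG0]) ?_ hδ0 ?_ t ht
    · intro n x y hx hy
      have h1 := abs_le.1 (hGmul n ⌊x * K n⌋₊ ⌊y * K n⌋₊)
      have hx' : 0 ≤ x * K n := mul_nonneg hx (hKr n).le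
      have hy' : 0 ≤ y * K n := mul_nonneg hy (hKr n).le
      have b1 : ⌊x * K n⌋₊ + ⌊y * K n⌋₊ ≤ ⌊(x + y) * K n⌋₊ := by
        refine Nat.le_floor ?_
        push_cast
        have := Nat.floor_le hx'
        have := Nat.floor_le hy'
        linarith
      have b2 : ⌊(x + y) * K n⌋₊ ≤ ⌊x * K n⌋₊ + ⌊y * K n⌋₊ + 1 := by
        refine Nat.lt_succ_iff.1 ((Nat.floor_lt (by positivity)).2 ?_)
        push_cast
        have := Nat.lt_floor_add_one (x * K n)
        have := Nat.lt_floor_add_one (y * K n)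
        linarith
      have c1 := hGanti n b1
      have c2 := hGanti n b2
      have c3 := hGD n (⌊x * K n⌋₊ + ⌊y * K n⌋₊)
      have c4 := hDa n (⌊x * K n⌋₊ + ⌊y * K n⌋₊)
      have c5 := (hApos' n).le
      simp only [hF, hδ]
      rw [abs_le]
      constructor
      · linarith [h1.1, h1.2]
      · have : 0 ≤ a n := c5
        linarith [h1.1, h1.2]
    · have e : ∀ n, F n 1 = G n (K n) := fun n => by simp [hF]
      simp only [e]
      have hl : Tendsto (fun n => Real.exp (-1) - a n) atTop (𝓝 (Real.exp (-1))) := by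
        simpa using ha0.const_sub (Real.exp (-1))
      exact tendsto_of_tendsto_of_tendsto_of_le_of_le hl tendsto_const_nhds hK2 hK1
  have hRlim : ∀ t, 0 < t → Tendsto (fun n => R n t) atTop (𝓝 (Real.exp (-t))) := by
    refine fun t ht => convex_deriv_exp F R a ha0 ?_ ?_ hFlim t ht
    · intro n t h hh hht
      have hle := hfl n (t - h) t (by linarith)
      obtain ⟨l, hl⟩ := Nat.exists_eq_add_of_le hle
      have h1 := hsge n ⌊(t - h) * K n⌋₊ l
      rw [← hl] at h1
      have b1 := Nat.floor_le (mul_nonneg (sub_nonneg.2 hht) (hKr n).le)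
      have b2 := Nat.lt_floor_add_one (t * K n)
      have b3 : h * K n ≤ l + 1 := by
        have : ((⌊t * K n⌋₊ : ℕ) : ℝ) = ⌊(t - h) * K n⌋₊ + l := by exact_mod_cast hl
        linarith
      have b4 := mul_le_mul_of_nonneg_right b3 (hDnn n ⌊t * K n⌋₊)
      have b5 := hDa n ⌊t * K n⌋₊
      simp only [hF, hR]
      linarith
    · intro n t h hh ht
      have hle := hfl n t (t + h) (by linarith)
      obtain ⟨l, hl⟩ := Nat.exists_eq_add_of_le hle
      have h1 := hsle n ⌊t * K n⌋₊ l
      rw [← hl] at h1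
      have b1 := Nat.floor_le (mul_nonneg (show 0 ≤ t + h by linarith) (hKr n).le)
      have b2 := Nat.lt_floor_add_one (t * K n)
      have b3 : (l : ℝ) ≤ h * K n + 1 := by
        have : ((⌊(t + h) * K n⌋₊ : ℕ) : ℝ) = ⌊t * K n⌋₊ + l := by exact_mod_cast hl
        linarith
      have b4 := mul_le_mul_of_nonneg_right b3 (hDnn n ⌊t * K n⌋₊)
      have b5 := hDa n ⌊t * K n⌋₊
      simp only [hF, hR]
      linarith
  have hlamc : ∀ n, ENNReal.ofReal (1 / (K n * a n)) * μ (A n) = ENNReal.ofReal (1 / K n) := by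
    intro n
    have : μ (A n) = ENNReal.ofReal (a n) := (ENNReal.ofReal_toReal (measure_ne_top _ _)).symm
    have h0 : 0 < a n := hApos' n
    have h1 := hKr n
    rw [this, ← ENNReal.ofReal_mul (by positivity)]
    congr 1
    field_simp
  refine ⟨fun n => 1 / (K n * a n), fun n => ?_, ?_, ?_⟩
  · have h0 : 0 < a n := hApos' n
    have h1 := hKr n
    refine ⟨by positivity, ?_⟩
    rw [div_le_iff₀ (by positivity)]
    have : 1 / 2 ≤ K n * a n := hK3 n
    linarith
  · refine (polya_exp F 0 le_rfl (fun n x y _ h => hGanti n (hfl n x y h))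
      (fun n x => hGnn _ _) hFlim).congr fun n => ?_
    refine iSup_congr fun t => ?_
    rw [set_eq_noHit (A n) (K n) (hK n) _ (hlamc n) t t.2]
    rfl
  · intro s hs
    refine (polya_exp R s hs.le (fun n x y _ h => mul_le_mul_of_nonneg_left
      (hDanti n (hfl n x y h)) (hKr n).le)
      (fun n x => mul_nonneg (hKr n).le (hDnn _ _))
      (fun t ht => hRlim t (hs.trans_le ht))).congr fun n => ?_
    refine iSup_congr fun t => ?_
    rw [set_eq_noHit (A n) (K n) (hK n) _ (hlamc n) t (hs.le.trans t.2)]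
    rw [ProbabilityTheory.cond_apply (coordSigma_le _ _ _ (hAmeas n)), ENNReal.toReal_mul,
      ENNReal.toReal_inv]
    have h0 : 0 < a n := hApos' n
    have e : (1 / (K n * a n))⁻¹ * ((a n)⁻¹ * D n ⌊(t : ℝ) * K n⌋₊) = R n t := by
      simp only [hR]
      field_simp
    rw [← e]
    rfl
end
end

section
/- Let (Σ, T, μ) be an ergodic measure-preserving shift system over a finite alphabet 𝒜 with positive entropy h_μ(T) > 0. Let D_0 > 0 be the smallest positive solution of (1 + D(card 𝒜 − 1)) / D^D = e^{h_μ(T)}. Then for every D ∈ (0, D_0) and every a ∈ Σ, the sequence of approximate-matching sets A_n = {b ∈ Σ : d_n(a, b) ≤ Dn} satisfies μ(τ_{A_n} ≤ n) → 0 as n → ∞. -/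
open MeasureTheory Filter Set
open scoped ENNReal Topology

noncomputable section

/-- `n`-th term of the sequence whose limit (as `n → ∞`) is the Kolmogorov–Sinai entropy
`h_μ(T)` of the shift: `-(1/n) ∑_{C cylinder of rank n} μ(C) log μ(C)`. -/
def entropySeq {𝒜 : Type*} [MeasurableSpace 𝒜] (μ : Measure (ℕ → 𝒜)) (n : ℕ) : ℝ :=
  -(1 / (n : ℝ)) * ∑' w : Fin n → 𝒜,
    (μ {y | ∀ i : Fin n, y (i : ℕ) = w i}).toReal *
      Real.log (μ {y | ∀ i : Fin n, y (i : ℕ) = w i}).toReal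

theorem mean_erg {X : Type*} [MeasurableSpace X] {μ : Measure X} [IsProbabilityMeasure μ]
    {T : X → X} (hT : Ergodic T μ) {f : X → ℝ} (hf : MemLp f 2 μ) {η : ℝ} (hη : 0 < η) :
    ∃ l : ℕ, 0 < l ∧
      ∫ x, |(∑ i ∈ Finset.range l, f (T^[i] x)) / (l : ℝ) - ∫ y, f y ∂μ| ∂μ ≤ η := by
  have hmp := hT.toMeasurePreserving
  let U : Lp ℝ 2 μ →L[ℝ] Lp ℝ 2 μ :=
    (Lp.compMeasurePreservingₗᵢ ℝ T hmp).toContinuousLinearMap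
  have hU : ‖U‖ ≤ 1 := LinearIsometry.norm_toContinuousLinearMap_le _
  let F : Lp ℝ 2 μ := hf.toLp f
  have hlim := U.tendsto_birkhoffAverage_orthogonalProjection hU F
  set G : Lp ℝ 2 μ := ((U.eqLocus (1 : Lp ℝ 2 μ →L[ℝ] Lp ℝ 2 μ)).orthogonalProjectionOnto F : Lp ℝ 2 μ) with hG
  have hGfix : U G = G :=
    ((U.eqLocus (1 : Lp ℝ 2 μ →L[ℝ] Lp ℝ 2 μ)).orthogonalProjectionOnto F).2
  have hGcomp : (G : X → ℝ) ∘ T =ᵐ[μ] G := by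
    have h1 : (U G : X → ℝ) =ᵐ[μ] G ∘ T := Lp.coeFn_compMeasurePreserving G hmp
    rw [hGfix] at h1
    exact h1.symm
  obtain ⟨c, hc⟩ := hT.ae_eq_const_of_ae_eq_comp_ae (Lp.aestronglyMeasurable G) hGcomp
  have hiter : ∀ k, (U^[k] F : X → ℝ) =ᵐ[μ] fun x => f (T^[k] x) := by
    intro k
    have h1 : U^[k] F = Lp.compMeasurePreserving T^[k] (hmp.iterate k) F := by
      rw [← Lp.compMeasurePreserving_iterate]; rfl
    rw [h1]
    refine (Lp.coeFn_compMeasurePreserving F (hmp.iterate k)).trans ?_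
    exact (hmp.iterate k).quasiMeasurePreserving.ae_eq_comp hf.coeFn_toLp
  have hsum : ∀ n, (∑ k ∈ Finset.range n, U^[k] F : Lp ℝ 2 μ) =ᵐ[μ]
      fun x => ∑ k ∈ Finset.range n, f (T^[k] x) := by
    intro n
    refine (Lp.coeFn_finsetSum _ _).trans ?_
    have := (ae_all_iff.2 hiter)
    filter_upwards [this] with x hx
    simp [hx]
  have havg : ∀ n, ((birkhoffAverage ℝ U _root_.id n F : Lp ℝ 2 μ) : X → ℝ) =ᵐ[μ]
      fun x => (∑ k ∈ Finset.range n, f (T^[k] x)) / (n : ℝ) := by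
    intro n
    simp only [birkhoffAverage, birkhoffSum, id]
    filter_upwards [Lp.coeFn_smul ((n : ℝ)⁻¹) (∑ k ∈ Finset.range n, U^[k] F), hsum n] with x h1 h2
    rw [h1, Pi.smul_apply, h2, smul_eq_mul, div_eq_inv_mul]
  have hfi : Integrable f μ := hf.integrable (by norm_num)
  have hAi : ∀ n : ℕ, Integrable (fun x => (∑ k ∈ Finset.range n, f (T^[k] x)) / (n : ℝ)) μ := by
    intro n
    refine Integrable.div_const (integrable_finsetSum _ fun k _ => ?_) _
    exact (hmp.iterate k).integrable_comp_of_integrable hfi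
  have hL1 : ∀ n, ∫ x, |(∑ i ∈ Finset.range n, f (T^[i] x)) / (n : ℝ) - c| ∂μ
      ≤ ‖birkhoffAverage ℝ U _root_.id n F - G‖ := by
    intro n
    set H := birkhoffAverage ℝ U _root_.id n F - G with hH
    have e1 : (H : X → ℝ) =ᵐ[μ] fun x => (∑ i ∈ Finset.range n, f (T^[i] x)) / (n : ℝ) - c := by
      filter_upwards [Lp.coeFn_sub (birkhoffAverage ℝ U _root_.id n F) G, havg n, hc] with x h1 h2 h3
      rw [hH, h1, Pi.sub_apply, h2, h3]; rfl
    have e2 : ∫ x, |(∑ i ∈ Finset.range n, f (T^[i] x)) / (n : ℝ) - c| ∂μ = ∫ x, ‖H x‖ ∂μ := by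
      refine integral_congr_ae ?_
      filter_upwards [e1] with x hx
      rw [hx]; rfl
    rw [e2, integral_norm_eq_lintegral_enorm (Lp.aestronglyMeasurable H), Lp.norm_def]
    refine ENNReal.toReal_mono (Lp.eLpNorm_ne_top H) ?_
    rw [← eLpNorm_one_eq_lintegral_enorm]
    exact eLpNorm_le_eLpNorm_of_exponent_le (by norm_num) (Lp.aestronglyMeasurable H)
  have hev : ∀ᶠ n in atTop, ‖birkhoffAverage ℝ U _root_.id n F - G‖ < η / 2 := by
    have := (tendsto_iff_norm_sub_tendsto_zero.1 hlim)
    exact this.eventually (gt_mem_nhds (by linarith))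
  obtain ⟨l, hl, hlpos⟩ := (hev.and (eventually_gt_atTop 0)).exists
  refine ⟨l, hlpos, ?_⟩
  have hb := (hL1 l).trans hl.le
  have hAvgInt : ∫ x, (∑ i ∈ Finset.range l, f (T^[i] x)) / (l : ℝ) ∂μ = ∫ y, f y ∂μ := by
    rw [integral_div, integral_finsetSum]
    · have : ∀ i, ∫ x, f (T^[i] x) ∂μ = ∫ y, f y ∂μ := by
        intro i
        have h1 := (hmp.iterate i)
        have h2 := integral_map (μ := μ) (φ := T^[i]) h1.measurable.aemeasurable (f := f)
          (by rw [h1.map_eq]; exact hf.1)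
        rw [h1.map_eq] at h2
        exact h2.symm
      simp only [this, Finset.sum_const, Finset.card_range, nsmul_eq_mul]
      have : (l : ℝ) ≠ 0 := by positivity
      field_simp
    · intro k _
      exact (hmp.iterate k).integrable_comp_of_integrable hfi
  have hcb : |c - ∫ y, f y ∂μ| ≤ η / 2 := by
    have : ∫ y, f y ∂μ - c = ∫ x, ((∑ i ∈ Finset.range l, f (T^[i] x)) / (l : ℝ) - c) ∂μ := by
      rw [integral_sub (hAi l) (integrable_const c), hAvgInt]; simp
    rw [abs_sub_comm, this]
    exact (abs_integral_le_integral_abs).trans hb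
  calc ∫ x, |(∑ i ∈ Finset.range l, f (T^[i] x)) / (l : ℝ) - ∫ y, f y ∂μ| ∂μ
      ≤ ∫ x, (|(∑ i ∈ Finset.range l, f (T^[i] x)) / (l : ℝ) - c| + η / 2) ∂μ := by
        refine integral_mono ?_ ?_ ?_
        · exact ((hAi l).sub (integrable_const _)).abs
        · exact ((hAi l).sub (integrable_const _)).abs.add (integrable_const _)
        · intro x
          have := abs_sub_le ((∑ i ∈ Finset.range l, f (T^[i] x)) / (l : ℝ)) c (∫ y, f y ∂μ)
          simp only
          linarith
    _ ≤ η := by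
        have hh : Integrable (fun x => |(∑ i ∈ Finset.range l, f (T^[i] x)) / (l : ℝ) - c|) μ :=
          ((hAi l).sub (integrable_const c)).abs
        rw [integral_add hh (integrable_const _)]
        simp only [integral_const, probReal_univ, one_smul]
        linarith

set_option linter.unusedSectionVars false
set_option linter.unusedVariables false

section Words

variable {𝒜 : Type*} [Fintype 𝒜] [DecidableEq 𝒜] [MeasurableSpace 𝒜] [DiscreteMeasurableSpace 𝒜]

/-- probability of a word -/
def pw (μ : Measure (ℕ → 𝒜)) (n : ℕ) (w : Fin n → 𝒜) : ℝ :=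
  (μ {y | ∀ i : Fin n, y (i : ℕ) = w i}).toReal

/-- restriction to the first `n` letters -/
def res (n : ℕ) (x : ℕ → 𝒜) : Fin n → 𝒜 := fun i => x i

/-- probability of the rank `n` cylinder around `x` -/
def Pc (μ : Measure (ℕ → 𝒜)) (n : ℕ) (x : ℕ → 𝒜) : ℝ := pw μ n (res n x)

/-- block entropy -/
def Hb (μ : Measure (ℕ → 𝒜)) (n : ℕ) : ℝ :=
  -∑ w : Fin n → 𝒜, pw μ n w * Real.log (pw μ n w)

/-- extension of a word to a sequence -/
def extw (a : ℕ → 𝒜) (n : ℕ) (w : Fin n → 𝒜) : ℕ → 𝒜 :=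
  fun i => if hi : i < n then w ⟨i, hi⟩ else a i

theorem measurable_res (n : ℕ) : Measurable (res (𝒜 := 𝒜) n) :=
  measurable_pi_lambda _ fun i => measurable_pi_apply _

theorem measurable_comp_res {β : Type*} [MeasurableSpace β] (n : ℕ) (G : (Fin n → 𝒜) → β) :
    Measurable (fun x => G (res n x)) :=
  (Measurable.of_discrete (f := G)).comp (measurable_res n)

variable (μ : Measure (ℕ → 𝒜)) [IsProbabilityMeasure μ]

theorem memLp_res (n : ℕ) (G : (Fin n → 𝒜) → ℝ) (p : ℝ≥0∞) :
    MemLp (fun x => G (res n x)) p μ := by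
  refine MemLp.of_bound (measurable_comp_res n G).aestronglyMeasurable (∑ w, ‖G w‖) ?_
  filter_upwards with x
  exact Finset.single_le_sum (f := fun w => ‖G w‖) (fun _ _ => norm_nonneg _) (Finset.mem_univ _)

theorem integrable_res (n : ℕ) (G : (Fin n → 𝒜) → ℝ) :
    Integrable (fun x => G (res n x)) μ :=
  memLp_one_iff_integrable.1 (memLp_res μ n G 1)

theorem integral_res (n : ℕ) (G : (Fin n → 𝒜) → ℝ) :
    ∫ x, G (res n x) ∂μ = ∑ w, pw μ n w * G w := by
  have : IsProbabilityMeasure (μ.map (res n)) :=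
    Measure.isProbabilityMeasure_map (measurable_res n).aemeasurable
  rw [← integral_map (measurable_res n).aemeasurable
    (Measurable.of_discrete (f := G)).aestronglyMeasurable]
  rw [integral_fintype (Integrable.of_finite)]
  refine Finset.sum_congr rfl fun w _ => ?_
  rw [smul_eq_mul]
  congr 1
  rw [Measure.real, Measure.map_apply (measurable_res n) (measurableSet_singleton w)]
  unfold pw
  congr 2
  ext y
  simp [res, funext_iff]

theorem pw_nonneg (n : ℕ) (w : Fin n → 𝒜) : 0 ≤ pw μ n w := ENNReal.toReal_nonneg

theorem ae_Pc_pos (n : ℕ) : ∀ᵐ x ∂μ, 0 < Pc μ n x := by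
  have h : μ (⋃ w : {w : Fin n → 𝒜 // pw μ n w = 0}, {y | ∀ i : Fin n, y (i : ℕ) = w.1 i}) = 0 := by
    refine measure_iUnion_null fun w => ?_
    have := w.2
    unfold pw at this
    rcases (ENNReal.toReal_eq_zero_iff _).1 this with h | h
    · exact h
    · exact absurd h (measure_ne_top _ _)
  rw [ae_iff]
  refine measure_mono_null ?_ h
  intro x hx
  have hx' : Pc μ n x = 0 := le_antisymm (not_lt.1 hx) (pw_nonneg _ _ _)
  refine mem_iUnion.2 ⟨⟨res n x, hx'⟩, fun i => rfl⟩

theorem sum_Pc_update (n : ℕ) (x : ℕ → 𝒜) :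
    ∑ b, Pc μ (n + 1) (Function.update x n b) = Pc μ n x := by
  unfold Pc pw
  rw [← ENNReal.toReal_sum (fun _ _ => measure_ne_top _ _),
    ← tsum_fintype (L := SummationFilter.unconditional _), ← measure_iUnion]
  · congr 2
    ext y
    simp only [mem_iUnion, mem_ofPred_eq, res]
    constructor
    · rintro ⟨b, hb⟩ i
      have := hb i.castSucc
      have hi : (i : ℕ) ≠ n := i.2.ne
      simpa [Function.update_of_ne hi] using this
    · intro hy
      refine ⟨y n, fun i => ?_⟩
      rcases Nat.lt_succ_iff_lt_or_eq.1 i.2 with h | h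
      · rw [Function.update_of_ne h.ne]
        exact hy ⟨i, h⟩
      · rw [h]; simp
  · intro b c hbc
    refine Set.disjoint_left.2 fun y hy hy' => hbc ?_
    have h1 := hy (Fin.last n)
    have h2 := hy' (Fin.last n)
    simp [res] at h1 h2
    rw [← h1, ← h2]
  · intro b
    have : {y : ℕ → 𝒜 | ∀ i : Fin (n+1), y i = res (n+1) (Function.update x n b) i}
        = res (n+1) ⁻¹' {res (n+1) (Function.update x n b)} := by
      ext y; simp [res, funext_iff]
    rw [this]
    exact measurable_res _ (measurableSet_singleton _)

theorem Hb_eq (n : ℕ) : Hb μ n = ∫ x, -Real.log (Pc μ n x) ∂μ := by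
  have := integral_res μ n (fun w => -Real.log (pw μ n w))
  unfold Pc
  rw [this]
  simp [Hb]

theorem gibbs (N : ℕ) (Q : (Fin N → 𝒜) → ℝ) (hQ : ∀ w, 0 ≤ Q w) (hQs : ∑ w, Q w ≤ 1)
    (F : (ℕ → 𝒜) → ℝ) (hF : Integrable F μ)
    (hFQ : ∀ᵐ x ∂μ, 0 < Q (res N x) ∧ -Real.log (Q (res N x)) ≤ F x) :
    Hb μ N ≤ ∫ x, F x ∂μ := by
  have hi := integrable_res μ N (fun w => Q w / pw μ N w)
  have h1 : ∫ x, Q (res N x) / pw μ N (res N x) ∂μ ≤ 1 := by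
    rw [integral_res μ N (fun w => Q w / pw μ N w)]
    refine le_trans (Finset.sum_le_sum fun w _ => ?_) hQs
    rcases eq_or_ne (pw μ N w) 0 with h | h
    · rw [h]; simpa using hQ w
    · rw [mul_div_cancel₀ _ h]
  have h2 : ∫ x, -Real.log (Pc μ N x) ∂μ
      ≤ ∫ x, (F x + (Q (res N x) / pw μ N (res N x) - 1)) ∂μ := by
    refine integral_mono_ae (integrable_res μ N (fun w => -Real.log (pw μ N w)))
      (hF.add (hi.sub (integrable_const 1))) ?_
    filter_upwards [hFQ, ae_Pc_pos μ N] with x hx hp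
    have hp' : 0 < pw μ N (res N x) := hp
    have := Real.log_le_sub_one_of_pos (div_pos hx.1 hp')
    rw [Real.log_div hx.1.ne' hp'.ne'] at this
    simp only [Pc]
    linarith [hx.2]
  rw [Hb_eq]
  refine h2.trans ?_
  have hi2 : Integrable (fun x => Q (res N x) / pw μ N (res N x) - 1) μ :=
    hi.sub (integrable_const 1)
  rw [integral_add hF hi2, integral_sub hi (integrable_const 1)]
  simp only [integral_const, probReal_univ, one_smul]
  linarith

theorem extw_snoc (a : ℕ → 𝒜) (N : ℕ) (b : 𝒜) (w : Fin N → 𝒜) :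
    extw a (N + 1) (Fin.snoc (α := fun _ => 𝒜) w b) = Function.update (extw a N w) N b := by
  funext i
  rcases lt_trichotomy i N with h | h | h
  · rw [Function.update_of_ne h.ne]
    simp [extw, h, Nat.lt_succ_of_lt h, Fin.snoc]
  · subst h
    simp [extw, Fin.snoc]
  · rw [Function.update_of_ne h.ne']
    have h1 : ¬ i < N := by omega
    have h2 : ¬ i < N + 1 := by omega
    simp [extw, h1, h2]

theorem causal_sum (a : ℕ → 𝒜) (r : ℕ → (ℕ → 𝒜) → ℝ) (hr : ∀ i x, 0 ≤ r i x)
    (hloc : ∀ i x y, (∀ j ≤ i, x j = y j) → r i x = r i y)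
    (hsum : ∀ i x, ∑ b, r i (Function.update x i b) ≤ 1) (N : ℕ) :
    ∑ w : Fin N → 𝒜, ∏ i ∈ Finset.range N, r i (extw a N w) ≤ 1 := by
  induction N with
  | zero => simp
  | succ N ih =>
    rw [← (Fin.snocEquiv (fun _ : Fin (N+1) => 𝒜)).sum_comp, Fintype.sum_prod_type_right]
    refine le_trans (Finset.sum_le_sum fun w _ => ?_) ih
    have : ∀ b : 𝒜, ∏ i ∈ Finset.range (N+1),
        r i (extw a (N+1) ((Fin.snocEquiv (fun _ : Fin (N+1) => 𝒜)) (b, w)))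
        = (∏ i ∈ Finset.range N, r i (extw a N w)) * r N (Function.update (extw a N w) N b) := by
      intro b
      have e : (Fin.snocEquiv (fun _ : Fin (N+1) => 𝒜)) (b, w)
        = Fin.snoc (α := fun _ => 𝒜) w b := rfl
      rw [Finset.prod_range_succ, e, extw_snoc]
      congr 1
      refine Finset.prod_congr rfl fun i hi => hloc _ _ _ fun j hj => ?_
      have := Finset.mem_range.1 hi
      rw [Function.update_of_ne (by omega)]
    simp only [this]
    rw [← Finset.mul_sum]
    exact mul_le_of_le_one_right (Finset.prod_nonneg fun i _ => hr _ _) (hsum _ _)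

end Words

section Numeric

theorem shift_sum_le (g : ℕ → ℝ) (B : ℝ) (h0 : ∀ i, 0 ≤ g i) (hB : ∀ i, g i ≤ B) (k n j : ℕ) :
    ∑ i ∈ Finset.range n, g (k + j + i) ≤ ∑ i ∈ Finset.range n, g (k + i) + j * B := by
  induction j with
  | zero => simp
  | succ j ih =>
    have h1 : ∑ i ∈ Finset.range n, g (k + (j + 1) + i) + g (k + j)
        = ∑ i ∈ Finset.range n, g (k + j + i) + g (k + j + n) := by
      rw [← Finset.sum_range_succ (fun i => g (k + j + i)),
        Finset.sum_range_succ' (fun i => g (k + j + i))]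
      simp only [add_zero, add_assoc, add_comm 1]
    have h2 := h0 (k + j)
    have h3 := hB (k + j + n)
    push_cast
    linarith

theorem start_sum_le (u : ℕ → ℝ) (C : ℝ) (hC : 0 ≤ C) (h0 : ∀ i, 0 ≤ u i) (m N : ℕ) :
    ∑ i ∈ Finset.range N, (if i < m then C else u (i - m)) ≤
      m * C + ∑ i ∈ Finset.range N, u i := by
  have key : ∑ i ∈ Finset.range N, (if i < m then C else u (i - m)) ≤
      (min N m : ℕ) * C + ∑ i ∈ Finset.range (N - m), u i := by
    induction N with
    | zero => simp
    | succ N ih =>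
      rw [Finset.sum_range_succ]
      rcases lt_or_ge N m with h | h
      · have e1 : min (N + 1) m = min N m + 1 := by omega
        have e2 : N + 1 - m = N - m := by omega
        rw [if_pos h, e1, e2]
        push_cast at ih ⊢
        linarith
      · have e1 : min (N + 1) m = min N m := by omega
        have e2 : N + 1 - m = (N - m) + 1 := by omega
        rw [if_neg (by omega), e1, e2, Finset.sum_range_succ]
        linarith
  have h1 : ∑ i ∈ Finset.range (N - m), u i ≤ ∑ i ∈ Finset.range N, u i :=
    Finset.sum_le_sum_of_subset_of_nonneg (Finset.range_subset_range.2 (by omega))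
      fun i _ _ => h0 i
  have h2 : ((min N m : ℕ) : ℝ) * C ≤ m * C :=
    mul_le_mul_of_nonneg_right (by exact_mod_cast min_le_right N m) hC
  linarith

theorem window_sum_ge (u v : ℕ → ℝ) (B C g : ℝ) (hC : 0 ≤ C) (hCB : C ≤ B)
    (h0 : ∀ i, 0 ≤ u i) (hB : ∀ i, u i ≤ B) (hv : ∀ i, 0 ≤ v i) (l : ℕ) (hl : 0 < l)
    (huv : ∀ i, g - v i ≤ (∑ j ∈ Finset.range l, u (i + j)) / l) (m n k : ℕ) (hk : k ≤ n) :
    n * g - ∑ i ∈ Finset.range (2 * n), v i - (l + m) * B ≤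
      ∑ i ∈ Finset.range n, (if k + i < m then C else u (k + i - m)) := by
  have hl' : (0 : ℝ) < l := by exact_mod_cast hl
  have hB0 : 0 ≤ B := hC.trans hCB
  -- step 1
  have s1 : ∑ i ∈ Finset.range n, u (k + i) ≤
      ∑ i ∈ Finset.range n, (if k + i < m then C else u (k + i - m)) + m * B := by
    have := shift_sum_le (fun i => if i < m then C else u (i - m)) B
      (fun i => by split_ifs; exacts [hC, h0 _])
      (fun i => by split_ifs; exacts [hCB, hB _]) k n m
    refine le_trans (le_of_eq ?_) this
    refine Finset.sum_congr rfl fun i _ => ?_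
    rw [if_neg (by omega)]
    congr 1; omega
  -- step 2
  have s2 : ∑ i ∈ Finset.range n, (∑ j ∈ Finset.range l, u (k + i + j)) / l ≤
      ∑ i ∈ Finset.range n, u (k + i) + l * B := by
    rw [← Finset.sum_div, div_le_iff₀ hl', Finset.sum_comm]
    calc ∑ j ∈ Finset.range l, ∑ i ∈ Finset.range n, u (k + i + j)
        ≤ ∑ j ∈ Finset.range l, (∑ i ∈ Finset.range n, u (k + i) + l * B) := by
          refine Finset.sum_le_sum fun j hj => ?_
          have h1 := shift_sum_le u B h0 hB k n j
          have h2 : (j : ℝ) * B ≤ l * B :=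
            mul_le_mul_of_nonneg_right (by exact_mod_cast (Finset.mem_range.1 hj).le) hB0
          simp only [add_right_comm k _ j]
          linarith
      _ = _ := by simp; ring
  have s3 : ∑ i ∈ Finset.range n, (g - v (k + i)) ≤
      ∑ i ∈ Finset.range n, (∑ j ∈ Finset.range l, u (k + i + j)) / l :=
    Finset.sum_le_sum fun i _ => huv _
  have s4 : ∑ i ∈ Finset.range n, v (k + i) ≤ ∑ i ∈ Finset.range (2 * n), v i := by
    have : ∑ i ∈ Finset.range n, v (k + i) = ∑ i ∈ Finset.Ico k (k + n), v i := by
      rw [Finset.sum_Ico_eq_sum_range]; simp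
    rw [this]
    refine Finset.sum_le_sum_of_subset_of_nonneg ?_ fun i _ _ => hv i
    intro i hi
    simp only [Finset.mem_Ico, Finset.mem_range] at hi ⊢
    omega
  rw [Finset.sum_sub_distrib] at s3
  simp only [Finset.sum_const, Finset.card_range, nsmul_eq_mul] at s3
  linarith

end Numeric

section Coding

variable {𝒜 : Type*} [Fintype 𝒜] [DecidableEq 𝒜] [MeasurableSpace 𝒜] [DiscreteMeasurableSpace 𝒜]
variable (μ : Measure (ℕ → 𝒜)) [IsProbabilityMeasure μ]

theorem shift_iter (j i : ℕ) (x : ℕ → 𝒜) : (shift 𝒜)^[j] x i = x (i + j) := by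
  induction j generalizing x with
  | zero => rfl
  | succ j ih =>
    rw [Function.iterate_succ_apply, ih]
    simp only [shift]
    congr 1

/-- conditional probability of the letter `m` given the previous `m` letters -/
def cnd (m : ℕ) (x : ℕ → 𝒜) : ℝ := Pc μ (m + 1) x / Pc μ m x

/-- conditional information -/
def ff (m : ℕ) (x : ℕ → 𝒜) : ℝ := -Real.log (cnd μ m x)

theorem Pc_nonneg (n : ℕ) (x : ℕ → 𝒜) : 0 ≤ Pc μ n x := pw_nonneg _ _ _

theorem Pc_congr (n : ℕ) (x y : ℕ → 𝒜) (h : ∀ i < n, x i = y i) : Pc μ n x = Pc μ n y := by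
  unfold Pc
  congr 1
  funext i
  exact h i i.2

theorem Pc_succ_le (m : ℕ) (x : ℕ → 𝒜) : Pc μ (m + 1) x ≤ Pc μ m x := by
  have h := sum_Pc_update μ m x
  have h1 := Finset.single_le_sum (f := fun b => Pc μ (m + 1) (Function.update x m b))
    (fun _ _ => Pc_nonneg _ _ _) (Finset.mem_univ (x m))
  simp only [Function.update_eq_self] at h1
  linarith

theorem cnd_nonneg (m : ℕ) (x : ℕ → 𝒜) : 0 ≤ cnd μ m x :=
  div_nonneg (Pc_nonneg _ _ _) (Pc_nonneg _ _ _)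

theorem ff_nonneg (m : ℕ) (x : ℕ → 𝒜) : 0 ≤ ff μ m x := by
  have : cnd μ m x ≤ 1 := div_le_one_of_le₀ (Pc_succ_le μ m x) (Pc_nonneg _ _ _)
  have := Real.log_nonpos (cnd_nonneg μ m x) this
  unfold ff
  linarith

/-- word version of `ff` -/
def fw (m : ℕ) (w : Fin (m + 1) → 𝒜) : ℝ :=
  -Real.log (pw μ (m + 1) w / pw μ m (fun i => w i.castSucc))

theorem ff_eq (m : ℕ) (x : ℕ → 𝒜) : ff μ m x = fw μ m (res (m + 1) x) := rfl

theorem ff_bdd (m : ℕ) : ∃ B, ∀ x, ff μ m x ≤ B := by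
  refine ⟨∑ w, |fw μ m w|, fun x => ?_⟩
  rw [ff_eq]
  exact (le_abs_self _).trans
    (Finset.single_le_sum (f := fun w => |fw μ m w|) (fun _ _ => abs_nonneg _) (Finset.mem_univ _))

theorem integral_ff (m : ℕ) : ∫ x, ff μ m x ∂μ = Hb μ (m + 1) - Hb μ m := by
  have i1 : ∀ n, Integrable (fun x => -Real.log (Pc μ n x)) μ := fun n =>
    integrable_res μ n (fun w => -Real.log (pw μ n w))
  rw [Hb_eq, Hb_eq, ← integral_sub (i1 (m + 1)) (i1 m)]
  refine integral_congr_ae ?_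
  filter_upwards [ae_Pc_pos μ (m + 1), ae_Pc_pos μ m] with x h1 h2
  unfold ff cnd
  rw [Real.log_div h1.ne' h2.ne']
  simp only [Pc]
  ring

/-- causal coding probabilities, with a window starting at `k` if `k ≥ 1` -/
def rk (m n : ℕ) (D : ℝ) (a : ℕ → 𝒜) (k i : ℕ) (x : ℕ → 𝒜) : ℝ :=
  if 1 ≤ k ∧ k ≤ i ∧ i < k + n then
    (if x i = a (i - k) then 1 else D) / (1 + D * ((Fintype.card 𝒜 : ℝ) - 1))
  else if i < m then 1 / (Fintype.card 𝒜 : ℝ) else cnd μ m ((shift 𝒜)^[i - m] x)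

theorem card_pos' (a : ℕ → 𝒜) : (1 : ℝ) ≤ Fintype.card 𝒜 := by
  have : Nonempty 𝒜 := ⟨a 0⟩
  exact_mod_cast Fintype.card_pos (α := 𝒜)

theorem Z_pos (a : ℕ → 𝒜) {D : ℝ} (hD : 0 < D) : 0 < 1 + D * ((Fintype.card 𝒜 : ℝ) - 1) := by
  have := card_pos' a
  have := mul_nonneg hD.le (sub_nonneg.2 this)
  linarith

theorem rk_nonneg (m n : ℕ) {D : ℝ} (hD : 0 < D) (a : ℕ → 𝒜) (k i : ℕ) (x : ℕ → 𝒜) :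
    0 ≤ rk μ m n D a k i x := by
  have := Z_pos a hD
  unfold rk
  split_ifs
  · positivity
  · positivity
  · positivity
  · exact cnd_nonneg _ _ _

theorem cnd_congr (m : ℕ) (x y : ℕ → 𝒜) (h : ∀ i ≤ m, x i = y i) : cnd μ m x = cnd μ m y := by
  unfold cnd
  rw [Pc_congr μ (m + 1) x y (fun i hi => h i (by omega)),
    Pc_congr μ m x y (fun i hi => h i (by omega))]

theorem rk_local (m n : ℕ) (D : ℝ) (a : ℕ → 𝒜) (k i : ℕ) (x y : ℕ → 𝒜)
    (h : ∀ j ≤ i, x j = y j) : rk μ m n D a k i x = rk μ m n D a k i y := by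
  unfold rk
  rw [h i le_rfl]
  by_cases him : i < m
  · simp only [him, if_true]
  · rw [cnd_congr μ m ((shift 𝒜)^[i - m] x) ((shift 𝒜)^[i - m] y)]
    intro j hj
    rw [shift_iter, shift_iter]
    exact h _ (by omega)

theorem rk_sum (m n : ℕ) {D : ℝ} (hD : 0 < D) (a : ℕ → 𝒜) (k i : ℕ) (x : ℕ → 𝒜) :
    ∑ b, rk μ m n D a k i (Function.update x i b) ≤ 1 := by
  have hZ := Z_pos a hD
  have hc := card_pos' a
  unfold rk
  by_cases hw : 1 ≤ k ∧ k ≤ i ∧ i < k + n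
  · simp only [hw, and_self, if_true, Function.update_self]
    rw [← Finset.sum_div, div_le_one hZ]
    have : ∀ b : 𝒜, (if b = a (i - k) then (1 : ℝ) else D)
        = D + (if b = a (i - k) then 1 - D else 0) := by
      intro b; split_ifs <;> ring
    simp only [this, Finset.sum_add_distrib, Finset.sum_ite_eq', Finset.mem_univ, if_true,
      Finset.sum_const, Finset.card_univ, nsmul_eq_mul]
    linarith
  · simp only [hw, if_false]
    by_cases him : i < m
    · simp only [him, if_true, Finset.sum_const, Finset.card_univ, nsmul_eq_mul]
      rw [mul_one_div_cancel (by positivity)]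
    · simp only [him, if_false]
      have e : ∀ b, (shift 𝒜)^[i - m] (Function.update x i b)
          = Function.update ((shift 𝒜)^[i - m] x) m b := by
        intro b
        funext j
        rw [shift_iter]
        by_cases hj : j = m
        · subst hj
          rw [Function.update_self, show j + (i - j) = i by omega, Function.update_self]
        · rw [Function.update_of_ne hj, Function.update_of_ne (by omega), shift_iter]
      simp only [e, cnd]
      have e2 : ∀ b, Pc μ m (Function.update ((shift 𝒜)^[i - m] x) m b)
          = Pc μ m ((shift 𝒜)^[i - m] x) := fun b =>
        Pc_congr _ _ _ _ fun j hj => Function.update_of_ne hj.ne _ _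
      simp only [e2]
      rw [← Finset.sum_div, sum_Pc_update]
      exact div_self_le_one _

theorem ae_cnd_pos (hE : MeasurePreserving (shift 𝒜) μ μ) (m : ℕ) :
    ∀ᵐ x ∂μ, ∀ i, 0 < cnd μ m ((shift 𝒜)^[i] x) := by
  rw [ae_all_iff]
  intro i
  refine (hE.iterate i).quasiMeasurePreserving.ae (p := fun x => 0 < cnd μ m x) ?_
  filter_upwards [ae_Pc_pos μ (m + 1), ae_Pc_pos μ m] with x h1 h2
  exact div_pos h1 h2

theorem rk_pos (m n : ℕ) {D : ℝ} (hD : 0 < D) (a : ℕ → 𝒜) (k i : ℕ) (x : ℕ → 𝒜)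
    (hx : ∀ i, 0 < cnd μ m ((shift 𝒜)^[i] x)) :
    0 < rk μ m n D a k i x := by
  have := Z_pos a hD
  have := card_pos' a
  unfold rk
  split_ifs
  · positivity
  · positivity
  · positivity
  · exact hx _

/-- cost without window -/
theorem neglog_rk_out (m n : ℕ) (D : ℝ) (a : ℕ → 𝒜) (k i : ℕ) (x : ℕ → 𝒜)
    (h : ¬ (1 ≤ k ∧ k ≤ i ∧ i < k + n)) :
    -Real.log (rk μ m n D a k i x) =
      if i < m then Real.log (Fintype.card 𝒜) else ff μ m ((shift 𝒜)^[i - m] x) := by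
  unfold rk
  rw [if_neg h]
  split_ifs
  · simp
  · rfl

theorem neglog_rk_in (m n : ℕ) {D : ℝ} (hD : 0 < D) (a : ℕ → 𝒜) (k i : ℕ) (x : ℕ → 𝒜)
    (hk : 1 ≤ k) (hi : i < n) :
    -Real.log (rk μ m n D a k (k + i) x) =
      Real.log (1 + D * ((Fintype.card 𝒜 : ℝ) - 1)) - if x (i + k) ≠ a i then Real.log D else 0 := by
  have hZ := Z_pos a hD
  unfold rk
  rw [if_pos ⟨hk, by omega, by omega⟩, show k + i - k = i by omega, add_comm k i]
  by_cases h : x (i + k) = a i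
  · simp [h]
  · simp only [h, if_false, ne_eq, not_false_eq_true, if_true]
    rw [Real.log_div hD.ne' hZ.ne']
    ring

theorem window_cost (m n : ℕ) {D : ℝ} (hD : 0 < D) (hD1 : D ≤ 1) (a : ℕ → 𝒜) (k : ℕ) (x : ℕ → 𝒜)
    (hk : 1 ≤ k)
    (hx : ((Finset.univ.filter fun i : Fin n => (shift 𝒜)^[k] x (i : ℕ) ≠ a (i : ℕ)).card : ℝ)
              ≤ D * n) :
    ∑ i ∈ Finset.range n, -Real.log (rk μ m n D a k (k + i) x) ≤
      n * (Real.log (1 + D * ((Fintype.card 𝒜 : ℝ) - 1)) - D * Real.log D) := by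
  rw [Finset.sum_congr rfl fun i hi => neglog_rk_in μ m n hD a k i x hk (Finset.mem_range.1 hi)]
  rw [Finset.sum_sub_distrib, Finset.sum_range (fun i => if x (i + k) ≠ a i then Real.log D else 0),
    ← Finset.sum_filter]
  simp only [shift_iter] at hx
  simp only [Finset.sum_const, Finset.card_range, nsmul_eq_mul]
  have hlog : Real.log D ≤ 0 := Real.log_nonpos hD.le hD1
  have := mul_le_mul_of_nonpos_right hx hlog
  linarith

end Coding

theorem hitTime_le_iff {X : Type*} (T : X → X) (A : Set X) (x : X) (n : ℕ) :
    hitTime T A x ≤ (n : ℕ∞) ↔ ∃ k, 1 ≤ k ∧ k ≤ n ∧ T^[k] x ∈ A := by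
  constructor
  · intro h
    by_contra hcon
    push Not at hcon
    have : ((n + 1 : ℕ) : ℕ∞) ≤ hitTime T A x := by
      unfold hitTime
      refine le_iInf₂ fun k hk => ?_
      have : n < k := by
        by_contra hkn
        exact hcon k hk.1 (by omega) hk.2
      exact_mod_cast this
    have h2 := this.trans h
    have : n + 1 ≤ n := by exact_mod_cast h2
    omega
  · rintro ⟨k, h1, h2, h3⟩
    unfold hitTime
    exact (iInf₂_le (f := fun k (_ : k ∈ {k : ℕ | 1 ≤ k ∧ T^[k] x ∈ A}) => (k : ℕ∞)) k ⟨h1, h3⟩).trans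
      (by exact_mod_cast h2)

section Core

variable {𝒜 : Type*} [Fintype 𝒜] [DecidableEq 𝒜] [MeasurableSpace 𝒜] [DiscreteMeasurableSpace 𝒜]
variable (μ : Measure (ℕ → 𝒜)) [IsProbabilityMeasure μ]

/-- the hitting event -/
def Ev (D : ℝ) (a : ℕ → 𝒜) (n : ℕ) : Set (ℕ → 𝒜) :=
  {x | hitTime (shift 𝒜)
            {b | ((Finset.univ.filter fun i : Fin n => b (i : ℕ) ≠ a (i : ℕ)).card : ℝ)
              ≤ D * n} x ≤ (n : ℕ∞)}

theorem measurableSet_Ev (hE : Measurable (shift 𝒜)) (D : ℝ) (a : ℕ → 𝒜) (n : ℕ) :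
    MeasurableSet (Ev D a n) := by
  have h1 : MeasurableSet
      {b : ℕ → 𝒜 | ((Finset.univ.filter fun i : Fin n => b (i : ℕ) ≠ a (i : ℕ)).card : ℝ)
              ≤ D * n} :=
    measurable_res n (MeasurableSet.of_discrete
      (s := {w : Fin n → 𝒜 | ((Finset.univ.filter fun i : Fin n => w i ≠ a (i : ℕ)).card : ℝ)
              ≤ D * n}))
  have : Ev D a n = ⋃ k ∈ {k : ℕ | 1 ≤ k ∧ k ≤ n}, (shift 𝒜)^[k] ⁻¹'
      {b | ((Finset.univ.filter fun i : Fin n => b (i : ℕ) ≠ a (i : ℕ)).card : ℝ)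
              ≤ D * n} := by
    ext x
    rw [Ev, mem_ofPred_eq, hitTime_le_iff]
    simp [and_assoc]
  rw [this]
  exact MeasurableSet.biUnion (Set.to_countable _) fun k _ => hE.iterate k h1

theorem integral_sum_iter (hE : MeasurePreserving (shift 𝒜) μ μ) {f : (ℕ → 𝒜) → ℝ}
    (hf : Integrable f μ) (N : ℕ) :
    Integrable (fun x => ∑ i ∈ Finset.range N, f ((shift 𝒜)^[i] x)) μ ∧
    ∫ x, ∑ i ∈ Finset.range N, f ((shift 𝒜)^[i] x) ∂μ = N * ∫ x, f x ∂μ := by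
  have hi : ∀ i, Integrable (fun x => f ((shift 𝒜)^[i] x)) μ := fun i =>
    (hE.iterate i).integrable_comp_of_integrable hf
  refine ⟨integrable_finsetSum _ fun i _ => hi i, ?_⟩
  rw [integral_finsetSum _ fun i _ => hi i]
  have : ∀ i, ∫ x, f ((shift 𝒜)^[i] x) ∂μ = ∫ y, f y ∂μ := by
    intro i
    have h1 := (hE.iterate i)
    have h2 := integral_map (μ := μ) (φ := (shift 𝒜)^[i]) h1.measurable.aemeasurable (f := f)
      (by rw [h1.map_eq]; exact hf.1)
    rw [h1.map_eq] at h2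
    exact h2.symm
  simp [this]

theorem neglog_prod (s : Finset ℕ) (g : ℕ → ℝ) (hg : ∀ i ∈ s, 0 < g i) :
    -Real.log (∏ i ∈ s, g i) = ∑ i ∈ s, -Real.log (g i) := by
  rw [Real.log_prod (fun i hi => (hg i hi).ne'), Finset.sum_neg_distrib]

theorem rk_ext (m n : ℕ) (D : ℝ) (a : ℕ → 𝒜) (k N : ℕ) (x : ℕ → 𝒜) :
    ∏ i ∈ Finset.range N, rk μ m n D a k i (extw a N (res N x))
      = ∏ i ∈ Finset.range N, rk μ m n D a k i x := by
  refine Finset.prod_congr rfl fun i hi => rk_local _ _ _ _ _ _ _ _ _ fun j hj => ?_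
  have : j < N := by have := Finset.mem_range.1 hi; omega
  simp [extw, this, res]

theorem integrable_ff (m : ℕ) : Integrable (ff μ m) μ := integrable_res μ (m + 1) (fw μ m)

theorem Hb_le_markov (hE : MeasurePreserving (shift 𝒜) μ μ) (a : ℕ → 𝒜) (m N : ℕ) :
    Hb μ N ≤ m * Real.log (Fintype.card 𝒜) + N * ∫ x, ff μ m x ∂μ := by
  have hlc : 0 ≤ Real.log (Fintype.card 𝒜) := Real.log_nonneg (card_pos' a)
  obtain ⟨i1, e1⟩ := integral_sum_iter μ hE (integrable_ff μ m) N
  have := gibbs μ N (fun w => ∏ i ∈ Finset.range N, rk μ m 0 1 a 0 i (extw a N w))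
    (fun w => Finset.prod_nonneg fun i _ => rk_nonneg μ m 0 one_pos a 0 i _)
    (causal_sum a _ (fun i x => rk_nonneg μ m 0 one_pos a 0 i x)
      (fun i x y h => rk_local μ m 0 1 a 0 i x y h) (fun i x => rk_sum μ m 0 one_pos a 0 i x) N)
    (fun x => m * Real.log (Fintype.card 𝒜) + ∑ i ∈ Finset.range N, ff μ m ((shift 𝒜)^[i] x))
    ((integrable_const _).add i1) ?_
  · rw [integral_add (integrable_const _) i1, e1] at this
    simpa using this
  · filter_upwards [ae_cnd_pos μ hE m] with x hx
    have hp := fun i => rk_pos μ m 0 one_pos a 0 i x hx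
    rw [rk_ext]
    refine ⟨Finset.prod_pos fun i _ => hp i, ?_⟩
    rw [neglog_prod _ _ fun i _ => hp i]
    rw [Finset.sum_congr rfl fun i _ => neglog_rk_out μ m 0 1 a 0 i x (by omega)]
    exact start_sum_le (fun i => ff μ m ((shift 𝒜)^[i] x)) _ hlc (fun i => ff_nonneg _ _ _) m N

theorem Hb_le_card (a : ℕ → 𝒜) (N : ℕ) : Hb μ N ≤ N * Real.log (Fintype.card 𝒜) := by
  have hc := card_pos' a
  have hc0 : (0 : ℝ) < Fintype.card 𝒜 := by linarith
  have := gibbs μ N (fun w => 1 / (Fintype.card 𝒜 : ℝ) ^ N) (fun w => by positivity)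
    (by simp [hc0.ne'])
    (fun x => N * Real.log (Fintype.card 𝒜)) (integrable_const _)
    (by filter_upwards with x
        refine ⟨by positivity, ?_⟩
        simp)
  simpa using this

theorem core (hE : MeasurePreserving (shift 𝒜) μ μ) (a : ℕ → 𝒜) (m n l : ℕ) (hl : 0 < l)
    {D : ℝ} (hD : 0 < D) (hD1 : D ≤ 1) (B : ℝ) (hB : ∀ x, ff μ m x ≤ B)
    (hCB : Real.log (Fintype.card 𝒜) ≤ B) (g φ η : ℝ)
    (hg : g = ∫ x, ff μ m x ∂μ)
    (hφ : φ = Real.log (1 + D * ((Fintype.card 𝒜 : ℝ) - 1)) - D * Real.log D)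
    (hη : ∫ x, |(∑ i ∈ Finset.range l, ff μ m ((shift 𝒜)^[i] x)) / (l : ℝ) - g| ∂μ ≤ η) :
    Hb μ (2 * n) ≤ Real.log (n + 1) + m * Real.log (Fintype.card 𝒜) + (l + m) * B
      + 2 * n * g + 2 * n * η - n * (g - φ) * (μ (Ev D a n)).toReal := by
  set C := Real.log (Fintype.card 𝒜) with hCdef
  have hC : 0 ≤ C := Real.log_nonneg (card_pos' a)
  have hB0 : 0 ≤ B := hC.trans hCB
  set v : (ℕ → 𝒜) → ℝ := fun x =>
    |(∑ i ∈ Finset.range l, ff μ m ((shift 𝒜)^[i] x)) / (l : ℝ) - g| with hv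
  have hvi : Integrable v μ :=
    (((integral_sum_iter μ hE (integrable_ff μ m) l).1.div_const _).sub (integrable_const _)).abs
  obtain ⟨i1, e1⟩ := integral_sum_iter μ hE (integrable_ff μ m) (2 * n)
  obtain ⟨i2, e2⟩ := integral_sum_iter μ hE hvi (2 * n)
  have hEm := measurableSet_Ev hE.measurable D a n
  set I : (ℕ → 𝒜) → ℝ := (Ev D a n).indicator (fun _ => n * (g - φ)) with hI
  have i3 : Integrable I μ := (integrable_const _).indicator hEm
  have e3 : ∫ x, I x ∂μ = n * (g - φ) * (μ (Ev D a n)).toReal := by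
    rw [hI, integral_indicator hEm]
    simp [Measure.real, mul_comm]
  set K : ℝ := Real.log (n + 1) + m * C + (l + m) * B with hK
  have i12 : Integrable (fun x => ∑ i ∈ Finset.range (2 * n), ff μ m ((shift 𝒜)^[i] x)
      + ∑ i ∈ Finset.range (2 * n), v ((shift 𝒜)^[i] x)) μ := i1.add i2
  have i123 : Integrable (fun x => ∑ i ∈ Finset.range (2 * n), ff μ m ((shift 𝒜)^[i] x)
      + ∑ i ∈ Finset.range (2 * n), v ((shift 𝒜)^[i] x) - I x) μ := i12.sub i3
  have hmain := gibbs μ (2 * n)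
    (fun w => (∑ k ∈ Finset.range (n + 1), ∏ i ∈ Finset.range (2 * n),
      rk μ m n D a k i (extw a (2 * n) w)) / (n + 1))
    (fun w => div_nonneg (Finset.sum_nonneg fun k _ => Finset.prod_nonneg fun i _ =>
      rk_nonneg μ m n hD a k i _) (by positivity))
    (by
      rw [← Finset.sum_div, div_le_one (by positivity), Finset.sum_comm]
      refine (Finset.sum_le_sum (g := fun _ => (1 : ℝ)) fun k _ => ?_).trans (by simp)
      exact causal_sum a _ (fun i x => rk_nonneg μ m n hD a k i x)
        (fun i x y h => rk_local μ m n D a k i x y h) (fun i x => rk_sum μ m n hD a k i x) _)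
    (fun x => K + (∑ i ∈ Finset.range (2 * n), ff μ m ((shift 𝒜)^[i] x)
      + ∑ i ∈ Finset.range (2 * n), v ((shift 𝒜)^[i] x) - I x))
    ((integrable_const _).add i123) ?_
  · rw [integral_add (integrable_const _) i123, integral_sub i12 i3, integral_add i1 i2, e1, e2, e3,
      ← hg] at hmain
    simp only [integral_const, probReal_univ, one_smul] at hmain
    push_cast at hmain
    have : 2 * (n : ℝ) * ∫ x, v x ∂μ ≤ 2 * n * η :=
      mul_le_mul_of_nonneg_left hη (by positivity)
    linarith
  · filter_upwards [ae_cnd_pos μ hE m] with x hx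
    have hp := fun k i => rk_pos μ m n hD a k i x hx
    simp only [rk_ext]
    have hprod : ∀ k, 0 < ∏ i ∈ Finset.range (2 * n), rk μ m n D a k i x := fun k =>
      Finset.prod_pos fun i _ => hp k i
    have hS : ∀ k ≤ n, ∏ i ∈ Finset.range (2 * n), rk μ m n D a k i x ≤
        ∑ k ∈ Finset.range (n + 1), ∏ i ∈ Finset.range (2 * n), rk μ m n D a k i x := fun k hk =>
      Finset.single_le_sum (f := fun k => ∏ i ∈ Finset.range (2 * n), rk μ m n D a k i x)
        (fun k _ => (hprod k).le) (Finset.mem_range.2 (by omega))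
    have hSpos := (hprod 0).trans_le (hS 0 (by omega))
    refine ⟨div_pos hSpos (by positivity), ?_⟩
    have hlogS : ∀ k ≤ n, -Real.log ((∑ k ∈ Finset.range (n + 1), ∏ i ∈ Finset.range (2 * n),
        rk μ m n D a k i x) / (n + 1)) ≤ Real.log (n + 1) +
        ∑ i ∈ Finset.range (2 * n), -Real.log (rk μ m n D a k i x) := by
      intro k hk
      rw [Real.log_div hSpos.ne' (by positivity), ← neglog_prod _ _ fun i _ => hp k i]
      have := Real.log_le_log (hprod k) (hS k hk)
      linarith
    set cst : ℕ → ℝ := fun i => if i < m then C else ff μ m ((shift 𝒜)^[i - m] x) with hcst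
    have hstart : ∑ i ∈ Finset.range (2 * n), cst i ≤
        m * C + ∑ i ∈ Finset.range (2 * n), ff μ m ((shift 𝒜)^[i] x) :=
      start_sum_le (fun i => ff μ m ((shift 𝒜)^[i] x)) C hC (fun i => ff_nonneg _ _ _) m (2 * n)
    have hv0 : ∀ y, 0 ≤ v y := fun y => abs_nonneg _
    by_cases hxE : x ∈ Ev D a n
    · obtain ⟨k, hk1, hkn, hkx⟩ := (hitTime_le_iff _ _ _ _).1 hxE
      refine (hlogS k hkn).trans ?_
      have hIx : I x = n * (g - φ) := Set.indicator_of_mem hxE _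
      rw [hIx]
      have hwin := window_cost μ m n hD hD1 a k x hk1 hkx
      rw [← hφ] at hwin
      have hge := window_sum_ge (fun i => ff μ m ((shift 𝒜)^[i] x)) (fun i => v ((shift 𝒜)^[i] x))
        B C g hC hCB (fun i => ff_nonneg _ _ _) (fun i => hB _) (fun i => hv0 _) l hl
        (by
          intro i
          have h1 : ∀ j, ff μ m ((shift 𝒜)^[i + j] x)
              = ff μ m ((shift 𝒜)^[j] ((shift 𝒜)^[i] x)) := by
            intro j
            rw [add_comm, Function.iterate_add_apply]
          simp only [h1]
          have := neg_abs_le ((∑ j ∈ Finset.range l,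
            ff μ m ((shift 𝒜)^[j] ((shift 𝒜)^[i] x))) / (l : ℝ) - g)
          simp only [hv]
          linarith) m n k hkn
      have hdiff : ∑ i ∈ Finset.range (2 * n), (-Real.log (rk μ m n D a k i x) - cst i)
          = ∑ i ∈ Finset.range n, (-Real.log (rk μ m n D a k (k + i) x) - cst (k + i)) := by
        have hs : ∑ i ∈ Finset.range n, (-Real.log (rk μ m n D a k (k + i) x) - cst (k + i))
            = ∑ i ∈ Finset.Ico k (k + n), (-Real.log (rk μ m n D a k i x) - cst i) := by
          rw [Finset.sum_Ico_eq_sum_range]; simp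
        rw [hs]
        symm
        refine Finset.sum_subset ?_ ?_
        · intro i hi
          simp only [Finset.mem_Ico, Finset.mem_range] at hi ⊢
          omega
        · intro i _ hi
          simp only [Finset.mem_Ico] at hi
          rw [neglog_rk_out μ m n D a k i x (by omega)]
          simp [hcst, hCdef]
      rw [Finset.sum_sub_distrib, Finset.sum_sub_distrib] at hdiff
      have hge' : n * g - ∑ i ∈ Finset.range (2 * n), v ((shift 𝒜)^[i] x) - (l + m) * B ≤
        ∑ i ∈ Finset.range n, cst (k + i) := hge
      linarith
    · refine (hlogS 0 (by omega)).trans ?_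
      have hIx : I x = 0 := Set.indicator_of_notMem hxE _
      rw [hIx, Finset.sum_congr rfl fun i _ => neglog_rk_out μ m n D a 0 i x (by omega)]
      have h1 : 0 ≤ ∑ i ∈ Finset.range (2 * n), v ((shift 𝒜)^[i] x) :=
        Finset.sum_nonneg fun i _ => hv0 _
      have h2 : 0 ≤ ((l : ℝ) + m) * B := by positivity
      have h3 : ∑ i ∈ Finset.range (2 * n), (if i < m then Real.log (Fintype.card 𝒜)
        else ff μ m ((shift 𝒜)^[i - m] x)) = ∑ i ∈ Finset.range (2 * n), cst i := rfl
      rw [h3]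
      linarith

end Core

theorem entropySeq_eq {𝒜 : Type*} [Fintype 𝒜] [DecidableEq 𝒜] [MeasurableSpace 𝒜]
    (μ : Measure (ℕ → 𝒜)) (n : ℕ) : entropySeq μ n = Hb μ n / n := by
  unfold entropySeq Hb pw
  rw [tsum_fintype]
  ring

theorem D_facts (c h : ℝ) (hc : 1 ≤ c) (hpos : 0 < h) (hhc : h ≤ Real.log c) (D₀ : ℝ)
    (hD₀min : ∀ D : ℝ, 0 < D →
      (1 + D * (c - 1)) / Real.rpow D D = Real.exp h → D₀ ≤ D)
    (D : ℝ) (hD : D ∈ Set.Ioo 0 D₀) :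
    D ≤ 1 ∧ Real.log (1 + D * (c - 1)) - D * Real.log D < h := by
  have key : ∀ t : ℝ, 0 < t → h ≤ Real.log (1 + t * (c - 1)) - t * Real.log t → D₀ ≤ t := by
    intro t ht hle
    have hZ : ∀ s : ℝ, 0 ≤ s → 0 < 1 + s * (c - 1) := by
      intro s hs
      have := mul_nonneg hs (sub_nonneg.2 hc)
      linarith
    have hcont : ContinuousOn (fun s : ℝ => Real.log (1 + s * (c - 1)) - s * Real.log s)
        (Set.Icc 0 t) := by
      refine ContinuousOn.sub (ContinuousOn.log (by fun_prop) ?_)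
        Real.continuous_mul_log.continuousOn
      intro s hs
      exact (hZ s hs.1).ne'
    obtain ⟨s, hs, hsh⟩ := intermediate_value_Icc ht.le hcont (show h ∈ Set.Icc _ _ from
      ⟨by simpa using hpos.le, hle⟩)
    have hs0 : s ≠ 0 := by
      rintro rfl
      simp at hsh
      linarith
    have hspos : 0 < s := lt_of_le_of_ne hs.1 (Ne.symm hs0)
    refine (hD₀min s hspos ?_).trans hs.2
    have e : Real.rpow s s = Real.exp (s * Real.log s) := by
      change s ^ s = _
      rw [Real.rpow_def_of_pos hspos, mul_comm]
    simp only at hsh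
    rw [e, ← hsh, Real.exp_sub, Real.exp_log (hZ s hs.1)]
  constructor
  · have := key 1 one_pos (by simpa using hhc)
    linarith [hD.2]
  · by_contra hcon
    have := key D hD.1 (not_lt.1 hcon)
    linarith [hD.2]

/-- **Approximate matching.**
For an ergodic shift system over a finite alphabet with positive entropy `h`, let `D₀ > 0`
be the smallest positive solution of `(1 + D(card 𝒜 − 1))/D^D = e^h`. Then for every
`D ∈ (0, D₀)` and every `a ∈ Σ`, the approximate-matching (Hamming ball) sets
`A_n = {b : d_n(a,b) ≤ Dn}` satisfy `μ(τ_{A_n} ≤ n) → 0`. -/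
theorem approximate_matching_hitting
    {𝒜 : Type*} [Fintype 𝒜] [DecidableEq 𝒜] [MeasurableSpace 𝒜] [DiscreteMeasurableSpace 𝒜]
    (μ : Measure (ℕ → 𝒜)) [IsProbabilityMeasure μ]
    (hErg : Ergodic (shift 𝒜) μ)
    (h : ℝ) (hent : Tendsto (entropySeq μ) atTop (𝓝 h)) (hpos : 0 < h)
    (D₀ : ℝ) (hD₀pos : 0 < D₀)
    (hD₀sol : (1 + D₀ * ((Fintype.card 𝒜 : ℝ) - 1)) / Real.rpow D₀ D₀ = Real.exp h)
    (hD₀min : ∀ D : ℝ, 0 < D →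
      (1 + D * ((Fintype.card 𝒜 : ℝ) - 1)) / Real.rpow D D = Real.exp h → D₀ ≤ D)
    (D : ℝ) (hD : D ∈ Set.Ioo 0 D₀) (a : ℕ → 𝒜) :
    Tendsto
      (fun n =>
        (μ {x | hitTime (shift 𝒜)
            {b | ((Finset.univ.filter fun i : Fin n => b (i : ℕ) ≠ a (i : ℕ)).card : ℝ)
              ≤ D * n} x ≤ (n : ℕ∞)}).toReal)
      atTop (𝓝 0) := by
  have hE := hErg.toMeasurePreserving
  have hc := card_pos' a
  have hent2 : Tendsto (fun n => Hb μ n / n) atTop (𝓝 h) :=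
    hent.congr fun n => entropySeq_eq μ n
  have hhc : h ≤ Real.log (Fintype.card 𝒜) := by
    refine le_of_tendsto hent2 ?_
    filter_upwards [eventually_gt_atTop 0] with n hn
    have hn' : (0 : ℝ) < n := by exact_mod_cast hn
    rw [div_le_iff₀ hn', mul_comm]
    exact Hb_le_card μ a n
  obtain ⟨hD1, hφ⟩ := D_facts (Fintype.card 𝒜) h hc hpos hhc D₀ hD₀min D hD
  set φ := Real.log (1 + D * ((Fintype.card 𝒜 : ℝ) - 1)) - D * Real.log D with hφdef
  change Tendsto (fun n => (μ (Ev D a n)).toReal) atTop (𝓝 0)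
  have hinv : Tendsto (fun n : ℕ => (n : ℝ)⁻¹) atTop (𝓝 0) := tendsto_inv_atTop_nhds_zero_nat
  have hlow : ∀ m, h ≤ ∫ x, ff μ m x ∂μ := by
    intro m
    have hlim : Tendsto (fun n : ℕ => m * Real.log (Fintype.card 𝒜) * (n : ℝ)⁻¹
        + ∫ x, ff μ m x ∂μ) atTop (𝓝 (m * Real.log (Fintype.card 𝒜) * 0 + ∫ x, ff μ m x ∂μ)) :=
      (hinv.const_mul _).add_const _
    rw [mul_zero, zero_add] at hlim
    refine le_of_tendsto_of_tendsto hent2 hlim ?_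
    filter_upwards [eventually_gt_atTop 0] with n hn
    have hn' : (0 : ℝ) < n := by exact_mod_cast hn
    rw [div_le_iff₀ hn', add_mul, mul_assoc, inv_mul_cancel₀ hn'.ne']
    have := Hb_le_markov μ hE a m n
    linarith
  have hup : ∀ δ > 0, ∃ m, ∫ x, ff μ m x ∂μ ≤ h + δ := by
    intro δ hδ
    by_contra hcon
    push Not at hcon
    have hH : ∀ n : ℕ, n * (h + δ) ≤ Hb μ n := by
      intro n
      induction n with
      | zero => simp [Hb, pw]
      | succ n ih =>
        have := hcon n
        rw [integral_ff] at this
        push_cast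
        linarith
    have : h + δ ≤ h := by
      refine ge_of_tendsto hent2 ?_
      filter_upwards [eventually_gt_atTop 0] with n hn
      have hn' : (0 : ℝ) < n := by exact_mod_cast hn
      rw [le_div_iff₀ hn', mul_comm]
      exact hH n
    linarith
  have hlogn : Tendsto (fun n : ℕ => Real.log (n + 1) / n) atTop (𝓝 0) := by
    have h1 := Real.tendsto_pow_log_div_mul_add_atTop 1 (-1) 1 one_ne_zero
    have h2 : Tendsto (fun n : ℕ => (n : ℝ) + 1) atTop atTop :=
      tendsto_atTop_add_const_right _ _ tendsto_natCast_atTop_atTop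
    refine (h1.comp h2).congr fun n => ?_
    simp
  refine Metric.tendsto_atTop'.2 fun ε hε => ?_
  have hgap : 0 < h - φ := by linarith
  set δ := ε * (h - φ) / 8 with hδdef
  have hδ : 0 < δ := by positivity
  obtain ⟨m, hm⟩ := hup δ hδ
  set g := ∫ x, ff μ m x ∂μ with hg
  obtain ⟨l, hl, hη⟩ := mean_erg hErg (memLp_res μ (m + 1) (fw μ m) 2) hδ
  obtain ⟨B₀, hB₀⟩ := ff_bdd μ m
  set B := max B₀ (Real.log (Fintype.card 𝒜)) with hBdef
  set K := m * Real.log (Fintype.card 𝒜) + (l + m) * B with hK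
  have h2n : Tendsto (fun n : ℕ => Hb μ (2 * n) / ((2 * n : ℕ) : ℝ)) atTop (𝓝 h) :=
    hent2.comp (tendsto_id.const_mul_atTop' (by norm_num : 0 < 2))
  have hR : Tendsto (fun n : ℕ => Real.log (n + 1) / n + K * (n : ℝ)⁻¹ + 2 * g + 2 * δ
      - 2 * (Hb μ (2 * n) / ((2 * n : ℕ) : ℝ))) atTop (𝓝 (0 + K * 0 + 2 * g + 2 * δ - 2 * h)) :=
    ((((hlogn.add (hinv.const_mul K)).add_const _).add_const _)).sub (h2n.const_mul 2)
  have hlt : 0 + K * 0 + 2 * g + 2 * δ - 2 * h < ε * (h - φ) := by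
    have : 8 * δ = ε * (h - φ) := by rw [hδdef]; ring
    linarith
  have hev := (hR.eventually (gt_mem_nhds hlt)).and (eventually_gt_atTop 0)
  obtain ⟨n₀, hn₀⟩ := eventually_atTop.1 hev
  refine ⟨n₀, fun n hn => ?_⟩
  obtain ⟨h1, hnpos⟩ := hn₀ n hn.le
  have hn' : (0 : ℝ) < n := by exact_mod_cast hnpos
  have hcore := core μ hE a m n l hl hD.1 hD1 B (fun x => (hB₀ x).trans (le_max_left _ _))
    (le_max_right _ _) g φ δ hg hφdef hη
  rw [Real.dist_eq, sub_zero, abs_of_nonneg ENNReal.toReal_nonneg]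
  set p := (μ (Ev D a n)).toReal with hp
  have hp0 : 0 ≤ p := ENNReal.toReal_nonneg
  have hA : n * (p * (g - φ)) ≤ n * (Real.log (n + 1) / n + K * (n : ℝ)⁻¹ + 2 * g + 2 * δ
      - 2 * (Hb μ (2 * n) / ((2 * n : ℕ) : ℝ))) := by
    have e : n * (Real.log (n + 1) / n + K * (n : ℝ)⁻¹ + 2 * g + 2 * δ
      - 2 * (Hb μ (2 * n) / ((2 * n : ℕ) : ℝ)))
      = Real.log (n + 1) + K + 2 * n * g + 2 * n * δ - Hb μ (2 * n) := by
      push_cast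
      field_simp
    rw [e]
    linarith
  have hA' := le_of_mul_le_mul_left hA hn'
  have hB' : p * (h - φ) ≤ p * (g - φ) :=
    mul_le_mul_of_nonneg_left (by linarith [hlow m]) hp0
  exact lt_of_mul_lt_mul_right (by linarith) hgap.le
end
end
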